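/- arXiv:2502.02778 — 3 statements merged into one kernel-verified Lean document; each statement's English description precedes it below -/
import Mathlib

section
/- Let X be a compact metric space with no isolated points and let f : X → X be a continuous map. Then the hyperspace of ω-limit sets ω(f) = { A ∈ 2^X : A = ω(x,f) for some x ∈ X } has empty interior as a subset of the hyperspace 2^X. -/
open TopologicalSpace Filter Topology

/-- The ω-limit set of a point `x` under a map `f`:
`ω(x,f) = ⋂ₙ cl { f^k(x) : k ≥ n }`. -/
def omegaLimitSet {X : Type*} [TopologicalSpace X] (f : X → X) (x : X) : Set X :=
  ⋂ n : ℕ, closure {y | ∃ k ≥ n, f^[k] x = y}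

/-- The hyperspace of ω-limit sets of `f`, as a subset of the hyperspace `2^X`
(nonempty compact = nonempty closed subsets of the compact metric space `X`,
with the Hausdorff metric). -/
def omegaHyperspace {X : Type*} [MetricSpace X] (f : X → X) :
    Set (NonemptyCompacts X) :=
  {A | ∃ x : X, (A : Set X) = omegaLimitSet f x}

theorem mem_omegaLimitSet_iff_mapClusterPt {X : Type*} [TopologicalSpace X] {f : X → X} {x y : X} :
    y ∈ omegaLimitSet f x ↔ MapClusterPt y atTop (fun n => f^[n] x) := by
  simp only [omegaLimitSet, Set.mem_iInter, mem_closure_iff_nhds, mapClusterPt_iff_frequently,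
    frequently_atTop]
  constructor
  · intro h s hs n
    obtain ⟨_, hz, k, hk, rfl⟩ := h n s hs
    exact ⟨k, hk, hz⟩
  · intro h n s hs
    obtain ⟨k, hk, hz⟩ := h s hs n
    exact ⟨_, hz, k, hk, rfl⟩

theorem omegaLimitSet_mapsTo {X : Type*} [TopologicalSpace X] {f : X → X} (hf : Continuous f)
    (x : X) : Set.MapsTo f (omegaLimitSet f x) (omegaLimitSet f x) := by
  intro y hy
  rw [mem_omegaLimitSet_iff_mapClusterPt, mapClusterPt_iff_frequently] at hy ⊢
  intro s hs
  rw [frequently_atTop]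
  intro n
  obtain ⟨k, hk, hks⟩ := frequently_atTop.1 (hy _ (hf.continuousAt hs)) n
  exact ⟨k + 1, by lia, by simpa [Function.iterate_succ_apply'] using hks⟩

theorem eventually_iterate_mem_of_omegaLimitSet_subset {X : Type*} [TopologicalSpace X]
    [CompactSpace X] {f : X → X} {x : X} {W : Set X} (hW : IsOpen W)
    (h : omegaLimitSet f x ⊆ W) : ∀ᶠ n in atTop, f^[n] x ∈ W := by
  by_contra hn
  obtain ⟨y, hy, hc⟩ := hW.isClosed_compl.isCompact.exists_mapClusterPt_of_frequently
    (not_eventually.1 hn)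
  exact hy (h (mem_omegaLimitSet_iff_mapClusterPt.2 hc))

/-- Weak incompressibility: an ω-limit set is not the union of two disjoint nonempty closed sets
one of which is forward invariant. -/
theorem omegaLimitSet_ne_union_of_mapsTo {X : Type*} [TopologicalSpace X] [CompactSpace X]
    [T2Space X] {f : X → X} (hf : Continuous f) {x : X} {A C : Set X} (hA : IsClosed A)
    (hC : IsClosed C) (hAC : Disjoint A C) (hA' : A.Nonempty) (hC' : C.Nonempty)
    (hinv : Set.MapsTo f A A) : omegaLimitSet f x ≠ A ∪ C := by
  intro h
  obtain ⟨U, V, hU, hV, hAU, hCV, hUV⟩ := normal_separation hA hC hAC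
  obtain ⟨a, ha⟩ := hA'
  obtain ⟨c, hc⟩ := hC'
  have hAU' : A ⊆ U ∩ f ⁻¹' U := fun z hz => ⟨hAU hz, hAU (hinv hz)⟩
  have hU' : IsOpen (U ∩ f ⁻¹' U) := hU.inter (hU.preimage hf)
  have hev := eventually_iterate_mem_of_omegaLimitSet_subset (hU'.union hV)
    (h.trans_subset (Set.union_subset_union hAU' hCV))
  obtain ⟨N, hN⟩ := eventually_atTop.1 hev
  have hfreq {y : X} (hy : y ∈ A ∪ C) {s : Set X} (hs : s ∈ 𝓝 y) (n : ℕ) :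
      ∃ k ≥ n, f^[k] x ∈ s :=
    frequently_atTop.1 (mapClusterPt_iff_frequently.1
      (mem_omegaLimitSet_iff_mapClusterPt.1 (h ▸ hy)) s hs) n
  obtain ⟨M, hM, hMU⟩ := hfreq (Or.inl ha) (hU'.mem_nhds (hAU' ha)) N
  have hstay : ∀ n ≥ M, f^[n] x ∈ U ∩ f ⁻¹' U := by
    intro n hn
    induction n, hn using Nat.le_induction with
    | base => exact hMU
    | succ n hn ih =>
      refine (hN (n + 1) (by lia)).resolve_right fun hv => ?_
      rw [Function.iterate_succ_apply'] at hv
      exact Set.disjoint_left.1 hUV ih.2 hv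
  obtain ⟨k, hk, hkV⟩ := hfreq (Or.inr hc) (hV.mem_nhds (hCV hc)) M
  exact Set.disjoint_left.1 hUV (hstay k hk).1 hkV

/-- If `X` is a compact metric space with no isolated points and `f : X → X` is
continuous, then `ω(f)` has empty interior in the hyperspace `2^X`. -/
theorem omegaHyperspace_interior_empty
    {X : Type*} [MetricSpace X] [CompactSpace X]
    (hX : ∀ x : X, (𝓝[≠] x).NeBot)
    (f : X → X) (hf : Continuous f) :
    interior (omegaHyperspace f) = ∅ := by
  rw [Set.eq_empty_iff_forall_notMem]
  intro A₀ hA₀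
  obtain ⟨K, hK, hKfin⟩ :=
    NonemptyCompacts.dense_setOfPred_finite.inter_open_nonempty _ isOpen_interior ⟨A₀, hA₀⟩
  obtain ⟨a, ha⟩ := K.nonempty
  have hcont : Continuous fun y : X => K ⊔ {y} :=
    continuous_const.sup NonemptyCompacts.continuous_singleton
  have hKa : K ⊔ {a} = K := by
    ext z
    simp +contextual [ha]
  have hnear : ∀ᶠ y in 𝓝[≠] a, K ⊔ {y} ∈ interior (omegaHyperspace f) :=
    nhdsWithin_le_nhds (hcont.continuousAt.preimage_mem_nhds
      (isOpen_interior.mem_nhds (by rwa [hKa])))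
  have hnotMem : ∀ᶠ y in 𝓝[≠] a, y ∉ (K : Set X) \ {a} :=
    nhdsWithin_le_nhds (hKfin.sdiff.isClosed.isOpen_compl.mem_nhds (by simp))
  have := hX a
  obtain ⟨y, ⟨hy, hyK⟩, hya⟩ := ((hnear.and hnotMem).and self_mem_nhdsWithin).exists
  obtain ⟨x, hx⟩ := interior_subset hK
  obtain ⟨x', hx'⟩ := interior_subset hy
  have hyK' : y ∉ (K : Set X) := fun h => hyK ⟨h, hya⟩
  refine omegaLimitSet_ne_union_of_mapsTo hf (x := x') K.isCompact.isClosed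
    (isClosed_singleton (x := y)) (Set.disjoint_singleton_right.2 hyK') K.nonempty
    (Set.singleton_nonempty y) ?_ ?_
  · rw [hx]
    exact omegaLimitSet_mapsTo hf x
  · rw [← hx']
    simp
end

section
/- Let D be a dendrite and f : D → D a continuous map. Suppose that for every arc A ⊆ D with endpoints a ≠ b there exists a point c ∈ A \ {a,b} such that ω(c,f) = D. Then the hyperspace of ω-limit sets ω(f) is a totally disconnected subspace of 2^D. -/
open TopologicalSpace Filter Topology

/-- Two points are linked at scale `ε` if some preconnected set, any two points of which are at
distance less than `ε`, contains both. -/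
def SmallLinked {X : Type*} [MetricSpace X] (ε : ℝ) (x y : X) : Prop :=
  ∃ S : Set X, IsPreconnected S ∧ x ∈ S ∧ y ∈ S ∧ ∀ u ∈ S, ∀ v ∈ S, dist u v < ε

theorem SmallLinked.refl {X : Type*} [MetricSpace X] {ε : ℝ} (hε : 0 < ε) (x : X) :
    SmallLinked ε x x :=
  ⟨{x}, isPreconnected_singleton, rfl, rfl, by rintro u rfl v rfl; simpa using hε⟩

theorem SmallLinked.dist_lt {X : Type*} [MetricSpace X] {ε : ℝ} {x y : X}
    (h : SmallLinked ε x y) : dist x y < ε := by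
  obtain ⟨S, -, hx, hy, hS⟩ := h
  exact hS x hx y hy

/-- A preconnected set covered by a finite family of open sets is crossed by chains of members of
the family whose length is at most the cardinality of the family. -/
theorem IsPreconnected.exists_chain_of_cover {X ι : Type*} [TopologicalSpace X] [Fintype ι]
    {V : ι → Set X} (hV : ∀ i, IsOpen (V i)) {S : Set X} (hS : IsPreconnected S)
    (hSV : S ⊆ ⋃ i, V i) {x y : X} (hx : x ∈ S) (hy : y ∈ S) :
    ∃ q : ℕ → ι, x ∈ V (q 0) ∧ (∀ j ≥ Fintype.card ι, y ∈ V (q j)) ∧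
      ∀ j, (S ∩ (V (q j) ∩ V (q (j + 1)))).Nonempty := by
  classical
  let G : SimpleGraph ι := SimpleGraph.fromRel fun i j => (S ∩ (V i ∩ V j)).Nonempty
  obtain ⟨i₀, hi₀⟩ := Set.mem_iUnion.1 (hSV hx)
  obtain ⟨i₁, hi₁, hr⟩ : ∃ i₁, y ∈ V i₁ ∧ G.Reachable i₀ i₁ := by
    by_contra! hcon
    obtain ⟨z, hz, hz₁, hz₂⟩ := hS (⋃ i ∈ {i | G.Reachable i₀ i}, V i)
      (⋃ i ∈ {i | ¬ G.Reachable i₀ i}, V i)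
      (isOpen_biUnion fun i _ => hV i) (isOpen_biUnion fun i _ => hV i)
      (fun z hz => by
        obtain ⟨i, hi⟩ := Set.mem_iUnion.1 (hSV hz)
        by_cases h : G.Reachable i₀ i
        · exact Or.inl (Set.mem_biUnion (by exact h) hi)
        · exact Or.inr (Set.mem_biUnion (by exact h) hi))
      ⟨x, hx, Set.mem_biUnion (SimpleGraph.Reachable.refl i₀) hi₀⟩
      (by
        obtain ⟨i, hi⟩ := Set.mem_iUnion.1 (hSV hy)
        exact ⟨y, hy, Set.mem_biUnion (hcon i hi) hi⟩)
    simp only [Set.mem_iUnion, Set.mem_ofPred_eq, exists_prop] at hz₁ hz₂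
    obtain ⟨i, hi, hzi⟩ := hz₁
    obtain ⟨j, hj, hzj⟩ := hz₂
    refine hj (hi.trans (SimpleGraph.Adj.reachable ?_))
    rw [SimpleGraph.fromRel_adj]
    exact ⟨fun h => hj (h ▸ hi), Or.inl ⟨z, hz, hzi, hzj⟩⟩
  obtain ⟨p, hp⟩ := hr.exists_isPath
  have hlen := hp.length_lt
  refine ⟨p.getVert, by simpa using hi₀, fun j hj => ?_, fun j => ?_⟩
  · rwa [p.getVert_of_length_le (by omega)]
  · by_cases hj : j < p.length
    · have := p.adj_getVert_succ hj
      rw [SimpleGraph.fromRel_adj] at this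
      rcases this.2 with h | h
      · exact h
      · rwa [Set.inter_comm (V _)]
    · rw [p.getVert_of_length_le (by omega), p.getVert_of_length_le (by omega)]
      exact ⟨y, hy, hi₁, hi₁⟩

/-- In a compact locally connected space, points linked at scale `ε` are joined by `δ`-chains of
uniformly bounded length. -/
theorem exists_uniform_chain {X : Type*} [MetricSpace X] [CompactSpace X]
    [LocallyConnectedSpace X] (ε : ℝ) {δ : ℝ} (hδ : 0 < δ) :
    ∃ K : ℕ, 0 < K ∧ ∀ x y : X, ∃ p : ℕ → X, SmallLinked ε x y →
      p 0 = x ∧ p K = y ∧ ∀ j, SmallLinked δ (p j) (p (j + 1)) ∧ dist (p j) x < ε := by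
  have hnhds : ∀ x : X, ∃ V : Set X, V ∈ 𝓝 x ∧ IsOpen V ∧ IsPreconnected V ∧
      ∀ u ∈ V, ∀ v ∈ V, dist u v < δ := fun x => by
    obtain ⟨V, hVs, hVo, hxV, hVc⟩ := locallyConnectedSpace_iff_subsets_isOpen_isConnected.1
      ‹_› x (Metric.ball x (δ / 2)) (Metric.ball_mem_nhds x (by positivity))
    refine ⟨V, hVo.mem_nhds hxV, hVo, hVc.isPreconnected, fun u hu v hv => ?_⟩
    have h₁ := Metric.mem_ball.1 (hVs hu)
    have h₂ := Metric.mem_ball'.1 (hVs hv)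
    linarith [dist_triangle u x v]
  choose V hVn hVo hVc hVd using hnhds
  obtain ⟨s, hs⟩ := CompactSpace.elim_nhds_subcover V hVn
  refine ⟨Fintype.card s + 1, by omega, fun x y => ?_⟩
  by_cases hxy : SmallLinked ε x y
  swap
  · exact ⟨fun _ => x, fun h => absurd h hxy⟩
  obtain ⟨S, hS, hxS, hyS, hSd⟩ := hxy
  obtain ⟨q, hq₀, hq₁, hq⟩ := hS.exists_chain_of_cover (V := fun i : s => V i)
    (fun i => hVo i) (by
      intro z _
      have : z ∈ ⋃ x ∈ s, V x := hs ▸ Set.mem_univ z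
      simpa using this) hxS hyS
  choose z hzS hz₁ hz₂ using hq
  set K := Fintype.card s + 1 with hK
  have hmem : ∀ j, (if j = 0 then x else if j < K then z (j - 1) else y) ∈ S ∩ V (q j) := by
    intro j
    split_ifs with h₀ h₁
    · subst h₀; exact ⟨hxS, hq₀⟩
    · obtain ⟨k, rfl⟩ := Nat.exists_eq_succ_of_ne_zero h₀
      exact ⟨hzS _, hz₂ _⟩
    · exact ⟨hyS, hq₁ j (by omega)⟩
  have hmem' : ∀ j, (if j + 1 < K then z j else y) ∈ V (q j) := by
    intro j
    split_ifs with h₁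
    · exact hz₁ _
    · exact hq₁ j (by omega)
  refine ⟨fun j => if j = 0 then x else if j < K then z (j - 1) else y, fun _ => ⟨by simp,
    by simp [hK], fun j => ⟨⟨V (q j), hVc _, (hmem j).2, by simpa using hmem' j, hVd _⟩, ?_⟩⟩⟩
  exact hSd _ (hmem j).1 _ hxS

/-- In a compact locally connected space, points linked at scale `ε` are joined by a path of
size at most `3 ε`. -/
theorem SmallLinked.exists_path {X : Type*} [MetricSpace X] [CompactSpace X]
    [LocallyConnectedSpace X] {ε : ℝ} (hε : 0 < ε) {x y : X} (hxy : SmallLinked ε x y) :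
    ∃ γ : Path x y, ∀ t, dist x (γ t) ≤ 3 * ε := by
  have hr : ∀ n : ℕ, 0 < ε / 2 ^ n := fun n => by positivity
  choose K hK c hc using fun n : ℕ => exists_uniform_chain (X := X) (ε / 2 ^ n) (hr (n + 1))
  let F : ℕ → ℕ → X := fun n => Nat.rec (fun k => if k = 0 then x else y)
    (fun n Fn k => c n (Fn (k / K n)) (Fn (k / K n + 1)) (k % K n)) n
  have hF : ∀ n k, F (n + 1) k = c n (F n (k / K n)) (F n (k / K n + 1)) (k % K n) :=
    fun _ _ => rfl
  have hlink : ∀ n k, SmallLinked (ε / 2 ^ n) (F n k) (F n (k + 1)) := by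
    intro n
    induction n with
    | zero =>
      intro k
      rcases Nat.eq_zero_or_pos k with rfl | hk
      · simpa [F] using hxy
      · simpa [F, hk.ne'] using SmallLinked.refl hε y
    | succ n ih =>
      intro k
      obtain ⟨-, -, h₂⟩ := hc n _ _ (ih (k / K n))
      have hlt := Nat.mod_lt k (hK n)
      rw [hF, hF]
      rcases Nat.lt_or_ge (k % K n + 1) (K n) with h | h
      · have e₁ : (k + 1) / K n = k / K n := by
          rw [Nat.succ_div_of_not_dvd]
          intro hd
          have := Nat.mod_eq_zero_of_dvd hd
          rw [Nat.add_mod, Nat.mod_eq_of_lt (a := 1) (by omega), Nat.mod_eq_of_lt h] at this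
          omega
        have e₂ : (k + 1) % K n = k % K n + 1 := by
          have := Nat.div_add_mod k (K n)
          have := Nat.div_add_mod (k + 1) (K n)
          rw [e₁] at this
          omega
        rw [e₁, e₂]
        exact (h₂ _).1
      · have hd : k + 1 = K n * (k / K n + 1) := by
          have := Nat.div_add_mod k (K n)
          rw [mul_add]
          omega
        have e₁ : (k + 1) / K n = k / K n + 1 := by
          rw [hd, Nat.mul_div_cancel_left _ (hK n)]
        have e₂ : (k + 1) % K n = 0 := by rw [hd, Nat.mul_mod_right]
        rw [e₁, e₂, (hc n _ _ (ih _)).1]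
        have := (h₂ (k % K n)).1
        rwa [show k % K n + 1 = K n by omega, (hc n _ _ (ih _)).2.1] at this
  let N : ℕ → ℕ := fun n => ∏ i ∈ Finset.range n, K i
  have hN : ∀ n, 0 < N n := fun n => Finset.prod_pos fun i _ => hK i
  have hNs : ∀ n, N (n + 1) = N n * K n := fun n => Finset.prod_range_succ _ _
  let g : ℕ → unitInterval → X := fun n t => F n ⌊(t : ℝ) * N n⌋₊
  have hgd : ∀ t n, dist (g n t) (g (n + 1) t) ≤ 2 * ε / 2 / 2 ^ n := by
    intro t n
    have hfl : ⌊(t : ℝ) * N (n + 1)⌋₊ / K n = ⌊(t : ℝ) * N n⌋₊ := by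
      rw [← Nat.floor_div_natCast, hNs, Nat.cast_mul, ← mul_assoc,
        mul_div_cancel_right₀ _ (Nat.cast_ne_zero.2 (hK n).ne')]
    have := ((hc n _ _ (hlink n ⌊(t : ℝ) * N n⌋₊)).2.2 (⌊(t : ℝ) * N (n + 1)⌋₊ % K n)).2
    simp only [g]
    rw [hF, hfl, dist_comm, mul_div_cancel_left₀ _ two_ne_zero]
    exact this.le
  choose γ hγ using fun t => cauchySeq_tendsto_of_complete
    (cauchySeq_of_le_geometric_two (hgd t))
  have hγd : ∀ t n, dist (g n t) (γ t) ≤ 2 * ε / 2 ^ n := fun t n =>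
    dist_le_of_le_geometric_two_of_tendsto (hgd t) (hγ t) n
  have h0 : ∀ n, F n 0 = x := by
    intro n
    induction n with
    | zero => rfl
    | succ n ih =>
      rw [hF, Nat.zero_mod, (hc n _ _ (hlink n _)).1, Nat.zero_div, ih]
  have h1 : ∀ n, F n (N n) = y := by
    intro n
    induction n with
    | zero => simp [N, F]
    | succ n ih =>
      rw [hF, hNs, Nat.mul_mod_left, (hc n _ _ (hlink n _)).1, Nat.mul_div_cancel _ (hK n), ih]
  have hnear : ∀ n (s t : unitInterval), s ≤ t → dist s t < 1 / N n →
      dist (g n s) (g n t) ≤ ε / 2 ^ n := by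
    intro n s t hst hd
    have hNpos : (0 : ℝ) < N n := Nat.cast_pos.2 (hN n)
    have hst' : (s : ℝ) ≤ t := hst
    have hd' : (t : ℝ) - s < 1 / N n := by
      rw [Subtype.dist_eq, Real.dist_eq, abs_sub_comm] at hd
      exact (le_abs_self _).trans_lt hd
    rw [lt_div_iff₀ hNpos] at hd'
    have hle : ⌊(s : ℝ) * N n⌋₊ ≤ ⌊(t : ℝ) * N n⌋₊ := Nat.floor_mono (by gcongr)
    have hle' : ⌊(t : ℝ) * N n⌋₊ ≤ ⌊(s : ℝ) * N n⌋₊ + 1 := by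
      rw [← Nat.floor_add_one (mul_nonneg s.2.1 hNpos.le)]
      exact Nat.floor_mono (by linarith)
    simp only [g]
    rcases Nat.eq_or_lt_of_le hle with h | h
    · rw [h, dist_self]; exact (hr n).le
    · rw [show ⌊(t : ℝ) * N n⌋₊ = ⌊(s : ℝ) * N n⌋₊ + 1 by omega]
      exact (hlink n _).dist_lt.le
  have hcont : Continuous γ := by
    rw [Metric.continuous_iff]
    intro t η hη
    obtain ⟨n, hn⟩ := exists_pow_lt_of_lt_one (show 0 < η / (5 * ε) by positivity)
      (show (1 / 2 : ℝ) < 1 by norm_num)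
    have hn' : 5 * (ε / 2 ^ n) < η := by
      rw [lt_div_iff₀ (by positivity)] at hn
      rw [one_div, inv_pow] at hn
      calc 5 * (ε / 2 ^ n) = (2 ^ n)⁻¹ * (5 * ε) := by ring
        _ < η := hn
    refine ⟨1 / N n, one_div_pos.2 (Nat.cast_pos.2 (hN n)), fun s hs => ?_⟩
    have h₁ : dist (g n s) (g n t) ≤ ε / 2 ^ n := by
      rcases le_total s t with h | h
      · exact hnear n s t h hs
      · rw [dist_comm]; exact hnear n t s h (by rwa [dist_comm])
    have h₂ := hγd s n
    have h₃ := hγd t n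
    rw [dist_comm] at h₂
    have h₄ := dist_triangle4 (γ s) (g n s) (g n t) (γ t)
    rw [mul_div_assoc] at h₂ h₃
    linarith
  refine ⟨⟨⟨γ, hcont⟩, ?_, ?_⟩, fun t => ?_⟩
  · refine tendsto_nhds_unique (hγ 0) ?_
    simp [g, h0]
  · refine tendsto_nhds_unique (hγ 1) ?_
    simp [g, h1]
  · have h₁ := hγd t 0
    have h₂ : dist x (g 0 t) ≤ ε := by
      by_cases h : ⌊(t : ℝ) * N 0⌋₊ = 0
      · simp [g, F, h, hε.le]
      · simpa [g, F, h] using hxy.dist_lt.le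
    have h₃ := dist_triangle x (g 0 t) (γ t)
    simp only [pow_zero, div_one] at h₁
    change dist x (γ t) ≤ _
    linarith

/-- A compact locally connected metric space is locally path connected. -/
theorem locallyPathConnectedSpace_of_compact_locallyConnected (X : Type*) [MetricSpace X]
    [CompactSpace X] [LocallyConnectedSpace X] : LocallyPathConnectedSpace X := by
  rw [locallyPathConnectedSpace_iff_pathComponentIn_mem_nhds]
  intro x u hu hxu
  obtain ⟨ε, hε, hball⟩ := Metric.isOpen_iff.1 hu x hxu
  obtain ⟨V, hVs, hVo, hxV, hVc⟩ := locallyConnectedSpace_iff_subsets_isOpen_isConnected.1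
      ‹_› x (Metric.ball x (ε / 8)) (Metric.ball_mem_nhds x (by positivity))
  refine mem_of_superset (hVo.mem_nhds hxV) fun y hy => ?_
  obtain ⟨γ, hγ⟩ := SmallLinked.exists_path (ε := ε / 4) (by positivity)
    ⟨V, hVc.isPreconnected, hxV, hy, fun u hu v hv => by
      have h₁ := Metric.mem_ball.1 (hVs hu)
      have h₂ := Metric.mem_ball'.1 (hVs hv)
      linarith [dist_triangle u x v]⟩
  refine ⟨γ, fun t => hball ?_⟩
  rw [Metric.mem_ball']
  linarith [hγ t]

/-- A closed set `K` of parameters is admissible for a path when the path takes the same value at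
both ends of every gap of `K`. -/
structure AdmissibleParams {X : Type*} (γ : unitInterval → X) (K : Set unitInterval) : Prop where
  isClosed : IsClosed K
  zero_mem : 0 ∈ K
  one_mem : 1 ∈ K
  eq_of_gap : ∀ s ∈ K, ∀ t ∈ K, s < t → (∀ u ∈ K, ¬ (s < u ∧ u < t)) → γ s = γ t

theorem AdmissibleParams.sInter {X : Type*} [MetricSpace X] (γ : C(unitInterval, X))
    {c : Set (Set unitInterval)} (hc : ∀ K ∈ c, AdmissibleParams γ K)
    (hchain : IsChain (· ⊆ ·) c) (hne : c.Nonempty) : AdmissibleParams γ (⋂₀ c) where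
  isClosed := isClosed_sInter fun K hK => (hc K hK).isClosed
  zero_mem := fun K hK => (hc K hK).zero_mem
  one_mem := fun K hK => (hc K hK).one_mem
  eq_of_gap := by
    intro s hs t ht hst hgap
    by_contra hne'
    obtain ⟨U, V, hU, hV, hsU, htV, hUV⟩ := t2_separation hne'
    obtain ⟨m, hsm, hmt⟩ := exists_between hst
    obtain ⟨s₁, ⟨hs₁, hs₁m⟩, hsU'⟩ := (mem_nhdsGE_iff_exists_mem_Ioc_Ico_subset hsm).1
      (mem_nhdsWithin_of_mem_nhds (γ.continuous.continuousAt.preimage_mem_nhds (hU.mem_nhds hsU)))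
    obtain ⟨t₁, ⟨hmt₁, ht₁⟩, htV'⟩ := (mem_nhdsLE_iff_exists_mem_Ico_Ioc_subset hmt).1
      (mem_nhdsWithin_of_mem_nhds (γ.continuous.continuousAt.preimage_mem_nhds (hV.mem_nhds htV)))
    obtain ⟨s₂, hs₂, hs₂'⟩ := exists_between hs₁
    obtain ⟨t₂, ht₂', ht₂⟩ := exists_between ht₁
    obtain ⟨K, hK, hKe⟩ : ∃ K ∈ c, K ∩ Set.Icc s₂ t₂ = ∅ := by
      by_contra! hcon
      have : Nonempty c := hne.to_subtype
      obtain ⟨z, hz⟩ := IsCompact.nonempty_iInter_of_directed_nonempty_isCompact_isClosed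
        (fun K : c => (K : Set unitInterval) ∩ Set.Icc s₂ t₂)
        (by
          intro K L
          rcases hchain.total K.2 L.2 with h | h
          · exact ⟨K, subset_rfl, Set.inter_subset_inter_left _ h⟩
          · exact ⟨L, Set.inter_subset_inter_left _ h, subset_rfl⟩)
        (fun K => hcon K K.2)
        (fun K => ((hc K K.2).isClosed.inter isClosed_Icc).isCompact)
        (fun K => (hc K K.2).isClosed.inter isClosed_Icc)
      rw [Set.mem_iInter] at hz
      have hz' := (hz (Classical.arbitrary c)).2
      exact hgap z (fun K hK => (hz ⟨K, hK⟩).1) ⟨hs₂.trans_le hz'.1, hz'.2.trans_lt ht₂⟩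
    have hKc := (hc K hK).isClosed
    obtain ⟨a, ⟨haK, has⟩, ha⟩ := (hKc.inter (isClosed_Iic (a := s₂))).isCompact.exists_isGreatest
      ⟨s, hs K hK, hs₂.le⟩
    obtain ⟨b, ⟨hbK, hbt⟩, hb⟩ := (hKc.inter (isClosed_Ici (a := t₂))).isCompact.exists_isLeast
      ⟨t, ht K hK, ht₂.le⟩
    have has' : s ≤ a := ha ⟨hs K hK, hs₂.le⟩
    have hbt' : b ≤ t := hb ⟨ht K hK, ht₂.le⟩
    simp only [Set.mem_Iic, Set.mem_Ici] at has hbt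
    have hst₂ : s₂ < t₂ := hs₂'.trans_le (hs₁m.trans (hmt₁.trans ht₂'.le))
    have hab := (hc K hK).eq_of_gap a haK b hbK (has.trans_lt (hst₂.trans_le hbt)) (by
      rintro u hu ⟨hau, hub⟩
      rcases le_total u s₂ with h | h
      · exact hau.not_ge (ha ⟨hu, h⟩)
      rcases le_total u t₂ with h' | h'
      · have : u ∈ K ∩ Set.Icc s₂ t₂ := ⟨hu, h, h'⟩
        rwa [hKe] at this
      · exact hub.not_ge (hb ⟨hu, h'⟩))
    have h₁ : γ a ∈ U := hsU' ⟨has', has.trans_lt hs₂'⟩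
    have h₂ : γ b ∈ V := htV' ⟨ht₂'.trans_le hbt, hbt'⟩
    exact Set.disjoint_left.1 hUV h₁ (hab ▸ h₂)

theorem AdmissibleParams.sdiff_Ioo {X : Type*} {γ : unitInterval → X} {K : Set unitInterval}
    (hK : AdmissibleParams γ K) {s t : unitInterval} (hs : s ∈ K) (ht : t ∈ K)
    (hγ : γ s = γ t) : AdmissibleParams γ (K \ Set.Ioo s t) where
  isClosed := hK.isClosed.sdiff isOpen_Ioo
  zero_mem := ⟨hK.zero_mem, fun h => unitInterval.nonneg'.not_gt h.1⟩
  one_mem := ⟨hK.one_mem, fun h => unitInterval.le_one'.not_gt h.2⟩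
  eq_of_gap := by
    rintro a ⟨ha, ha'⟩ b ⟨hb, hb'⟩ hab hgap
    by_cases h : ∀ u ∈ K, ¬ (a < u ∧ u < b)
    · exact hK.eq_of_gap a ha b hb hab h
    push Not at h
    obtain ⟨u, hu, hau, hub⟩ := h
    have hust : u ∈ Set.Ioo s t := by
      by_contra hcon
      exact hgap u ⟨hu, hcon⟩ ⟨hau, hub⟩
    have hs' := hgap s ⟨hs, fun h => lt_irrefl _ h.1⟩
    have ht' := hgap t ⟨ht, fun h => lt_irrefl _ h.2⟩
    simp only [Set.mem_Ioo, not_and, not_lt] at *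
    have h₁ : a = s := le_antisymm
      (not_lt.1 fun h => (hau.trans hust.2).not_ge (ha' h))
      (not_lt.1 fun h => (hust.1.trans hub).not_ge (hs' h))
    have h₂ : b = t := le_antisymm
      (ht' (hau.trans hust.2)) (hb' (hust.1.trans hub))
    rw [h₁, h₂, hγ]

/-- Removing loops: every path contains a path all of whose fibers are order-connected. -/
theorem exists_monotone_path {X : Type*} [MetricSpace X] (γ : C(unitInterval, X)) :
    ∃ σ : C(unitInterval, X), σ 0 = γ 0 ∧ σ 1 = γ 1 ∧ Set.range σ ⊆ Set.range γ ∧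
      ∀ s u t, s ≤ u → u ≤ t → σ s = σ t → σ u = σ s := by
  obtain ⟨K, -, hK, hmin⟩ := zorn_superset_nonempty {K | AdmissibleParams γ K}
    (fun c hc hchain hne => ⟨⋂₀ c, AdmissibleParams.sInter γ hc hchain hne,
      fun s hs => Set.sInter_subset_of_mem hs⟩) Set.univ
    { isClosed := isClosed_univ
      zero_mem := trivial
      one_mem := trivial
      eq_of_gap := fun s _ t _ hst h => by
        obtain ⟨m, hm⟩ := exists_between hst
        exact absurd hm (h m trivial) }
  have hK : AdmissibleParams γ K := hK
  have hgap : ∀ s ∈ K, ∀ t ∈ K, γ s = γ t → ∀ u ∈ K, ¬ (s < u ∧ u < t) := by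
    intro s hs t ht hst u hu hsut
    exact (hmin (hK.sdiff_Ioo hs ht hst) Set.sdiff_subset hu).2 hsut
  have hr : ∀ u, ∃ r, IsGreatest (K ∩ Set.Iic u) r := fun u =>
    (hK.isClosed.inter isClosed_Iic).isCompact.exists_isGreatest ⟨0, hK.zero_mem, unitInterval.nonneg'⟩
  have hl : ∀ u, ∃ r, IsLeast (K ∩ Set.Ici u) r := fun u =>
    (hK.isClosed.inter isClosed_Ici).isCompact.exists_isLeast ⟨1, hK.one_mem, unitInterval.le_one'⟩
  choose r hr using hr
  choose l hl using hl
  have hrK : ∀ u, r u ∈ K := fun u => (hr u).1.1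
  have hru : ∀ u, r u ≤ u := fun u => (hr u).1.2
  have hlK : ∀ u, l u ∈ K := fun u => (hl u).1.1
  have hlu : ∀ u, u ≤ l u := fun u => (hl u).1.2
  have hrl : ∀ u, γ (r u) = γ (l u) := by
    intro u
    rcases ((hru u).trans (hlu u)).eq_or_lt with h | h
    · rw [h]
    · refine hK.eq_of_gap _ (hrK u) _ (hlK u) h ?_
      rintro v hv ⟨h₁, h₂⟩
      rcases le_total v u with h | h
      · exact h₁.not_ge ((hr u).2 ⟨hv, h⟩)
      · exact h₂.not_ge ((hl u).2 ⟨hv, h⟩)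
  have hrmono : Monotone r := fun s t hst => (hr t).2 ⟨hrK s, (hru s).trans hst⟩
  have hrfix : ∀ u ∈ K, r u = u := fun u hu => le_antisymm (hru u) ((hr u).2 ⟨hu, Set.self_mem_Iic⟩)
  have hcont : Continuous fun u => γ (r u) := by
    have hunif := Metric.uniformContinuous_iff.1
      (CompactSpace.uniformContinuous_of_continuous γ.continuous)
    rw [Metric.continuous_iff]
    intro t ε hε
    obtain ⟨δ, hδ, hδε⟩ := hunif ε hε
    have key : ∀ s t : unitInterval, s ≤ t → dist s t < δ → dist (γ (r s)) (γ (r t)) < ε := by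
      intro s t hst hd
      rcases lt_or_ge (r t) s with h | h
      · have : r s = r t := le_antisymm (hrmono hst) ((hr s).2 ⟨hrK t, h.le⟩)
        rwa [this, dist_self]
      · rw [hrl s]
        have h₁ : l s ≤ r t := (hl s).2 ⟨hrK t, h⟩
        have h₂ : (s : ℝ) ≤ l s := hlu s
        have h₃ : (r t : ℝ) ≤ t := hru t
        have h₄ : (l s : ℝ) ≤ r t := h₁
        apply hδε
        rw [Subtype.dist_eq, Real.dist_eq, abs_sub_comm] at hd ⊢
        rw [abs_of_nonneg (by linarith)] at hd ⊢
        linarith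
    refine ⟨δ, hδ, fun s hs => ?_⟩
    rcases le_total s t with h | h
    · exact key s t h hs
    · rw [dist_comm]
      exact key t s h (by rwa [dist_comm])
  refine ⟨⟨_, hcont⟩, ?_, ?_, ?_, ?_⟩
  · exact congrArg γ (hrfix 0 hK.zero_mem)
  · exact congrArg γ (hrfix 1 hK.one_mem)
  · rintro _ ⟨u, rfl⟩
    exact ⟨r u, rfl⟩
  · intro s u t hsu hut hst
    change γ (r s) = γ (r t) at hst
    change γ (r u) = γ (r s)
    have h := hgap _ (hrK s) _ (hrK t) hst _ (hrK u)
    rcases (hrmono hsu).eq_or_lt with h₁ | h₁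
    · rw [h₁]
    rcases (hrmono hut).eq_or_lt with h₂ | h₂
    · rw [h₂, hst]
    · exact absurd ⟨h₁, h₂⟩ h

/-- A path with order-connected fibers can be reparametrized to an injective path. -/
theorem exists_injective_reparametrization {X : Type*} [MetricSpace X] [CompactSpace X]
    (σ : C(unitInterval, X)) (hσ : ∀ s u t, s ≤ u → u ≤ t → σ s = σ t → σ u = σ s)
    (h01 : σ 0 ≠ σ 1) :
    ∃ g : C(unitInterval, X), Function.Injective g ∧ g 0 = σ 0 ∧ g 1 = σ 1 ∧
      Set.range g ⊆ Set.range σ := by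
  let q : ℕ → unitInterval := denseSeq unitInterval
  let d : ℕ → unitInterval → ℝ := fun n u => Metric.infDist (σ u) (σ '' Set.Iic (q n))
  let h : ℕ → unitInterval → ℝ := fun n t => sSup ((fun v => d n (min t v)) '' Set.univ)
  let C : ℝ := Metric.diam (Set.univ : Set X)
  have hdc : ∀ n, Continuous (d n) := fun n =>
    (Metric.continuous_infDist_pt _).comp σ.continuous
  have hd0 : ∀ n u, 0 ≤ d n u := fun n u => Metric.infDist_nonneg
  have hdC : ∀ n u, d n u ≤ C := fun n u =>
    (Metric.infDist_le_dist_of_mem (Set.mem_image_of_mem σ (Set.mem_Iic.2 unitInterval.nonneg'))).trans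
      (Metric.dist_le_diam_of_mem isCompact_univ.isBounded trivial trivial)
  have hdz : ∀ n u, u ≤ q n → d n u = 0 := fun n u hu =>
    Metric.infDist_zero_of_mem (Set.mem_image_of_mem σ (Set.mem_Iic.2 hu))
  have hhc : ∀ n, Continuous (h n) := fun n =>
    isCompact_univ.continuous_sSup (f := fun t v => d n (min t v))
      ((hdc n).comp (continuous_fst.min continuous_snd))
  have hbdd : ∀ n t, BddAbove ((fun v => d n (min t v)) '' Set.univ) := fun n t =>
    ⟨C, by rintro _ ⟨v, -, rfl⟩; exact hdC _ _⟩
  have hle : ∀ n u t, u ≤ t → d n u ≤ h n t := fun n u t hut =>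
    le_csSup (hbdd n t) ⟨u, trivial, by simp only [min_eq_right hut]⟩
  have hub : ∀ n t b, (∀ u ≤ t, d n u ≤ b) → h n t ≤ b := fun n t b hb =>
    csSup_le (Set.univ_nonempty.image _) (by
      rintro _ ⟨v, -, rfl⟩
      exact hb _ (min_le_left _ _))
  have hmono : ∀ n, Monotone (h n) := fun n s t hst =>
    hub n s _ fun u hu => hle n u t (hu.trans hst)
  have hh0 : ∀ n t, 0 ≤ h n t := fun n t => (hd0 n t).trans (hle n t t le_rfl)
  have hhC : ∀ n t, h n t ≤ C := fun n t => hub n t C fun u _ => hdC n u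
  have hhz : ∀ n t, t ≤ q n → h n t = 0 := fun n t ht =>
    le_antisymm (hub n t 0 fun u hu => (hdz n u (hu.trans ht)).le) (hh0 n t)
  let φ : unitInterval → ℝ := fun t => ∑' n, (1 / 2 : ℝ) ^ n * h n t
  have hsumC : Summable fun n : ℕ => (1 / 2 : ℝ) ^ n * C := summable_geometric_two.mul_right C
  have hsum : ∀ t, Summable fun n => (1 / 2 : ℝ) ^ n * h n t := fun t =>
    Summable.of_nonneg_of_le (fun n => mul_nonneg (by positivity) (hh0 n t))
      (fun n => mul_le_mul_of_nonneg_left (hhC n t) (by positivity)) hsumC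
  have hφc : Continuous φ := continuous_tsum (fun n => continuous_const.mul (hhc n)) hsumC
    fun n t => by
      rw [Real.norm_of_nonneg (mul_nonneg (by positivity) (hh0 n t))]
      exact mul_le_mul_of_nonneg_left (hhC n t) (by positivity)
  have hφle : Monotone φ := fun s t hst => (hsum s).tsum_le_tsum
    (fun n => mul_le_mul_of_nonneg_left (hmono n hst) (by positivity)) (hsum t)
  have hφlt : ∀ s t, s ≤ t → σ s ≠ σ t → φ s < φ t := by
    intro s t hst hne
    have hlt : s < t := lt_of_le_of_ne hst fun e => hne (e ▸ rfl)
    obtain ⟨w, ⟨hsw, hwt⟩, hw⟩ := (mem_nhdsGE_iff_exists_mem_Ioc_Ico_subset hlt).1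
      (mem_nhdsWithin_of_mem_nhds (σ.continuous.continuousAt.preimage_mem_nhds
        (isOpen_compl_singleton.mem_nhds (show σ s ∈ ({σ t}ᶜ : Set X) from hne))))
    obtain ⟨_, ⟨hsq, hqw⟩, n, rfl⟩ := (denseRange_denseSeq unitInterval).exists_mem_open
      isOpen_Ioo (Set.nonempty_Ioo.2 hsw) |>.elim fun n hn =>
        (⟨_, hn, n, rfl⟩ : ∃ z, z ∈ Set.Ioo s w ∧ ∃ n, q n = z)
    have hqt : σ (q n) ≠ σ t := hw ⟨hsq.le, hqw⟩
    have hpos : 0 < d n t := by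
      refine (((isClosed_Iic.isCompact.image σ.continuous).isClosed.notMem_iff_infDist_pos
        ⟨_, Set.mem_image_of_mem σ (Set.mem_Iic.2 unitInterval.nonneg')⟩).1 ?_)
      rintro ⟨u, hu, hut⟩
      exact hqt ((hσ u (q n) t hu (hqw.le.trans hwt) hut).trans hut)
    refine (hsum s).tsum_lt_tsum (i := n)
      (fun n => mul_le_mul_of_nonneg_left (hmono n hst) (by positivity)) ?_ (hsum t)
    refine mul_lt_mul_of_pos_left ?_ (by positivity)
    rw [hhz n s hsq.le]
    exact hpos.trans_le (hle n t t le_rfl)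
  have hφeq : ∀ s t, s ≤ t → σ s = σ t → φ s = φ t := by
    intro s t hst heq
    refine tsum_congr fun n => congrArg _ (le_antisymm (hmono n hst) (hub n t _ fun u hu => ?_))
    rcases le_total u s with h' | h'
    · exact hle n u s h'
    · have : d n u = d n s := by simp only [d, hσ s u t h' hu heq]
      rw [this]
      exact hle n s s le_rfl
  have hφ0 : φ 0 = 0 := by
    simp only [φ, hhz _ 0 unitInterval.nonneg', mul_zero, tsum_zero]
  have hM : 0 < φ 1 := hφ0 ▸ hφlt 0 1 unitInterval.nonneg' h01
  let ψ : C(unitInterval, unitInterval) :=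
    ⟨fun t => ⟨φ t / φ 1, div_nonneg (hφ0 ▸ hφle unitInterval.nonneg') hM.le,
      (div_le_one hM).2 (hφle unitInterval.le_one')⟩, by fun_prop⟩
  have hψ0 : ψ 0 = 0 := Subtype.ext (by simp [ψ, hφ0])
  have hψ1 : ψ 1 = 1 := Subtype.ext (by simp [ψ, hM.ne'])
  have hψ : ∀ s t, ψ s = ψ t ↔ σ s = σ t := by
    have hψφ : ∀ s t, ψ s = ψ t ↔ φ s = φ t := fun s t =>
      Subtype.ext_iff.trans (div_left_inj' hM.ne')
    intro s t
    rw [hψφ]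
    rcases le_total s t with h' | h'
    · exact ⟨fun e => by_contra fun hne => (hφlt s t h' hne).ne e, hφeq s t h'⟩
    · exact ⟨fun e => by_contra fun hne => (hφlt t s h' (Ne.symm hne)).ne e.symm,
        fun e => (hφeq t s h' e.symm).symm⟩
  have hsurj : Function.Surjective ψ := fun y =>
    intermediate_value_univ 0 1 ψ.continuous ⟨hψ0.le.trans unitInterval.nonneg', unitInterval.le_one'.trans hψ1.ge⟩
  have hquot : IsQuotientMap ψ := .of_surjective_continuous hsurj ψ.continuous
  have hlift : ∀ t, hquot.lift σ (fun s t e => (hψ s t).1 e) (ψ t) = σ t := fun t =>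
    DFunLike.congr_fun (hquot.lift_comp σ fun s t e => (hψ s t).1 e) t
  refine ⟨hquot.lift σ fun s t e => (hψ s t).1 e, ?_, ?_, ?_, ?_⟩
  · intro y z hyz
    obtain ⟨s, rfl⟩ := hsurj y
    obtain ⟨t, rfl⟩ := hsurj z
    rw [hlift, hlift] at hyz
    exact (hψ s t).2 hyz
  · simpa only [hψ0] using hlift 0
  · simpa only [hψ1] using hlift 1
  · rintro _ ⟨y, rfl⟩
    obtain ⟨s, rfl⟩ := hsurj y
    exact ⟨s, (hlift s).symm⟩

/-- Distinct points joined by a path inside a set are joined by an arc inside that set. -/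
theorem JoinedIn.exists_injective {X : Type*} [MetricSpace X] [CompactSpace X] {U : Set X}
    {x y : X} (h : JoinedIn U x y) (hxy : x ≠ y) :
    ∃ g : C(unitInterval, X), Function.Injective g ∧ g 0 = x ∧ g 1 = y ∧ ∀ t, g t ∈ U := by
  obtain ⟨γ, hγ⟩ := h
  obtain ⟨σ, h₀, h₁, hr, hσ⟩ := exists_monotone_path (γ : C(unitInterval, X))
  replace h₀ : σ 0 = x := h₀.trans γ.source
  replace h₁ : σ 1 = y := h₁.trans γ.target
  obtain ⟨g, hg, hg₀, hg₁, hgr⟩ := exists_injective_reparametrization σ hσ (by rwa [h₀, h₁])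
  refine ⟨g, hg, hg₀.trans h₀, hg₁.trans h₁, fun t => ?_⟩
  obtain ⟨s, hs⟩ := hr (hgr ⟨t, rfl⟩)
  exact hs ▸ hγ s

/-- Two arcs with common ends, the interior of one being disjoint from the other, form a
circle. -/
theorem exists_homeomorph_circle_of_arcs {X : Type*} [TopologicalSpace X] [T2Space X]
    {α β : ℝ → X} (hα : Continuous α) (hβ : Continuous β)
    (hαi : Set.InjOn α (Set.Icc 0 1)) (hβi : Set.InjOn β (Set.Icc 0 1))
    (h0 : α 0 = β 0) (h1 : α 1 = β 1)
    (hdisj : ∀ t ∈ Set.Ioo (0 : ℝ) 1, ∀ s ∈ Set.Icc (0 : ℝ) 1, α t ≠ β s) :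
    ∃ S : Set X, Nonempty (S ≃ₜ Circle) := by
  let h : ℝ → X := fun t => if t ≤ 1 then α t else β (2 - t)
  have hc : Continuous h := Continuous.if_le hα (hβ.comp (by fun_prop)) continuous_id
    continuous_const fun t ht => by
      rw [show t = 1 from ht, h1]; norm_num
  have : Fact ((0 : ℝ) < 2) := ⟨two_pos⟩
  have hcross : ∀ s t : ℝ, 0 ≤ s → s ≤ 1 → 1 < t → t < 2 → α s ≠ β (2 - t) := by
    intro s t hs0 hs1 ht1 ht2 e
    rcases hs0.eq_or_lt with rfl | hs0
    · rw [h0] at e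
      have := hβi ⟨le_rfl, zero_le_one⟩ ⟨by linarith, by linarith⟩ e
      linarith
    rcases hs1.eq_or_lt with rfl | hs1
    · rw [h1] at e
      have := hβi ⟨zero_le_one, le_rfl⟩ ⟨by linarith, by linarith⟩ e
      linarith
    · exact hdisj s ⟨hs0, hs1⟩ (2 - t) ⟨by linarith, by linarith⟩ e
  have hinj : Set.InjOn h (Set.Ico 0 2) := by
    rintro s ⟨hs0, hs2⟩ t ⟨ht0, ht2⟩ e
    simp only [h] at e
    split_ifs at e with hs ht ht
    · exact hαi ⟨hs0, hs⟩ ⟨ht0, ht⟩ e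
    · exact absurd e (hcross s t hs0 hs (not_le.1 ht) ht2)
    · exact absurd e.symm (hcross t s ht0 ht (not_le.1 hs) hs2)
    · have := hβi ⟨by linarith, by linarith⟩ ⟨by linarith, by linarith⟩ e
      linarith
  have hLc : Continuous (AddCircle.liftIco (2 : ℝ) 0 h) :=
    AddCircle.liftIco_zero_continuous (by simp [h, h0]) hc.continuousOn
  have hLi : Function.Injective (AddCircle.liftIco (2 : ℝ) 0 h) := by
    intro x y e
    obtain ⟨s, hs, rfl⟩ : ∃ s ∈ Set.Ico (0 : ℝ) 2, (s : AddCircle (2 : ℝ)) = x :=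
      ⟨_, by simpa using (AddCircle.equivIco 2 0 x).2, AddCircle.coe_equivIco⟩
    obtain ⟨t, ht, rfl⟩ : ∃ s ∈ Set.Ico (0 : ℝ) 2, (s : AddCircle (2 : ℝ)) = y :=
      ⟨_, by simpa using (AddCircle.equivIco 2 0 y).2, AddCircle.coe_equivIco⟩
    rw [AddCircle.liftIco_zero_coe_apply hs, AddCircle.liftIco_zero_coe_apply ht] at e
    rw [hinj hs ht e]
  exact ⟨_, ⟨(hLc.isClosedEmbedding hLi).isEmbedding.toHomeomorph.symm.trans
    (AddCircle.homeomorphCircle two_ne_zero)⟩⟩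

/-- The affine parametrization of the segment from `p` to `q` in the unit interval. -/
noncomputable def segmentParam (p q : unitInterval) (x : ℝ) : unitInterval :=
  Set.projIcc 0 1 zero_le_one ((p : ℝ) + (q - p) * x)

theorem continuous_segmentParam (p q : unitInterval) : Continuous (segmentParam p q) :=
  continuous_projIcc.comp (by fun_prop)

theorem coe_segmentParam (p q : unitInterval) {x : ℝ} (hx : x ∈ Set.Icc (0 : ℝ) 1) :
    (segmentParam p q x : ℝ) = p + (q - p) * x := by
  have hp := p.2
  have hq := q.2
  have h : (p : ℝ) + (q - p) * x ∈ Set.Icc (0 : ℝ) 1 := by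
    constructor
    · nlinarith [hp.1, hq.1, hx.1, hx.2, mul_nonneg hq.1 hx.1,
        mul_nonneg hp.1 (sub_nonneg.2 hx.2)]
    · nlinarith [hp.2, hq.2, hx.1, hx.2, mul_nonneg (sub_nonneg.2 hq.2) hx.1,
        mul_nonneg (sub_nonneg.2 hp.2) (sub_nonneg.2 hx.2)]
  rw [segmentParam, Set.projIcc_of_mem _ h]

theorem segmentParam_zero (p q : unitInterval) : segmentParam p q 0 = p :=
  Subtype.ext (by rw [coe_segmentParam p q ⟨le_rfl, zero_le_one⟩]; ring)

theorem segmentParam_one (p q : unitInterval) : segmentParam p q 1 = q :=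
  Subtype.ext (by rw [coe_segmentParam p q ⟨zero_le_one, le_rfl⟩]; ring)

theorem injOn_segmentParam {p q : unitInterval} (hpq : p ≠ q) :
    Set.InjOn (segmentParam p q) (Set.Icc 0 1) := by
  intro x hx y hy e
  have e' := congrArg Subtype.val e
  rw [coe_segmentParam p q hx, coe_segmentParam p q hy] at e'
  exact mul_left_cancel₀ (sub_ne_zero.2 fun h => hpq (Subtype.ext h.symm)) (add_left_cancel e')

/-- Two different arcs with the same ends contain a circle in their union. -/
theorem exists_homeomorph_circle_of_ne_arcs {X : Type*} [TopologicalSpace X] [T2Space X]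
    {g k : C(unitInterval, X)} (hg : Function.Injective g) (hk : Function.Injective k)
    (h0 : g 0 = k 0) (h1 : g 1 = k 1) {t₀ : unitInterval} (ht₀ : g t₀ ∉ Set.range k) :
    ∃ S : Set X, Nonempty (S ≃ₜ Circle) := by
  have hcl : IsClosed (g ⁻¹' Set.range k) :=
    (isCompact_range k.continuous).isClosed.preimage g.continuous
  obtain ⟨s, ⟨⟨p, hp⟩, hst⟩, hs⟩ :=
    (hcl.inter (isClosed_Iic (a := t₀))).isCompact.exists_isGreatest
      ⟨0, ⟨0, h0.symm⟩, unitInterval.nonneg'⟩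
  obtain ⟨u, ⟨⟨q, hq⟩, htu⟩, hu⟩ :=
    (hcl.inter (isClosed_Ici (a := t₀))).isCompact.exists_isLeast
      ⟨1, ⟨1, h1.symm⟩, unitInterval.le_one'⟩
  have hst' : s < t₀ := lt_of_le_of_ne hst fun e => ht₀ (e ▸ ⟨p, hp⟩)
  have htu' : t₀ < u := lt_of_le_of_ne htu fun e => ht₀ (e ▸ ⟨q, hq⟩)
  have hsu := hst'.trans htu'
  have hpq : p ≠ q := by
    rintro rfl
    exact hsu.ne (hg (hp.symm.trans hq))
  refine exists_homeomorph_circle_of_arcs (α := g ∘ segmentParam s u) (β := k ∘ segmentParam p q)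
    (g.continuous.comp (continuous_segmentParam s u))
    (k.continuous.comp (continuous_segmentParam p q))
    (hg.comp_injOn (injOn_segmentParam hsu.ne)) (hk.comp_injOn (injOn_segmentParam hpq))
    ?_ ?_ ?_
  · simp [segmentParam_zero, hp]
  · simp [segmentParam_one, hq]
  · rintro x hx y - e
    have hmem : segmentParam s u x ∈ g ⁻¹' Set.range k := ⟨_, e.symm⟩
    have hv := coe_segmentParam s u ⟨hx.1.le, hx.2.le⟩
    have hsu' : (s : ℝ) < u := hsu
    have h₁ : s < segmentParam s u x := by
      change (s : ℝ) < _
      rw [hv]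
      nlinarith [hx.1, mul_pos (sub_pos.2 hsu') hx.1]
    have h₂ : segmentParam s u x < u := by
      change _ < (u : ℝ)
      rw [hv]
      nlinarith [hx.2, mul_pos (sub_pos.2 hsu') (sub_pos.2 hx.2)]
    rcases le_total (segmentParam s u x) t₀ with h | h
    · exact h₁.not_ge (hs ⟨hmem, h⟩)
    · exact h₂.not_ge (hu ⟨hmem, h⟩)

/-- In a compact locally connected space without circles, an interior point of an arc separates
its ends: some open set contains the last end, does not have the first one in its closure, and has
no other boundary point. -/
theorem exists_isOpen_frontier_subset_singleton {X : Type*} [MetricSpace X] [CompactSpace X]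
    [LocallyConnectedSpace X] (hX : ¬ ∃ S : Set X, Nonempty (S ≃ₜ Circle))
    {g : C(unitInterval, X)} (hg : Function.Injective g) {t : unitInterval} (h0 : t ≠ 0)
    (h1 : t ≠ 1) :
    ∃ P : Set X, IsOpen P ∧ g 1 ∈ P ∧ g 0 ∉ closure P ∧ frontier P ⊆ {g t} := by
  have := locallyPathConnectedSpace_of_compact_locallyConnected X
  have ho : IsOpen ({g t}ᶜ : Set X) := isOpen_compl_singleton
  have hmem0 : g 0 ∈ ({g t}ᶜ : Set X) := fun h => h0 (hg h).symm
  have hmem1 : g 1 ∈ ({g t}ᶜ : Set X) := fun h => h1 (hg h).symm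
  set P := connectedComponentIn ({g t}ᶜ) (g 1) with hP
  have hPo : IsOpen P := ho.connectedComponentIn
  have h1P : g 1 ∈ P := mem_connectedComponentIn hmem1
  have hclos : ∀ z ∈ closure P, z ≠ g t → z ∈ P := by
    intro z hz hne
    obtain ⟨w, hw, hwP⟩ := mem_closure_iff.1 hz _ (ho.connectedComponentIn (x := z))
      (mem_connectedComponentIn hne)
    rw [hP, connectedComponentIn_eq hwP, ← connectedComponentIn_eq hw]
    exact mem_connectedComponentIn hne
  have h0P : g 0 ∉ P := by
    intro h
    have hpc : IsPathConnected P :=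
      hPo.isConnected_iff_isPathConnected.1 ⟨⟨_, h1P⟩, isPreconnected_connectedComponentIn⟩
    obtain ⟨k, hk, hk0, hk1, hkP⟩ := (hpc.joinedIn _ h _ h1P).exists_injective
      (fun e => zero_ne_one (hg e))
    refine hX (exists_homeomorph_circle_of_ne_arcs hg hk hk0.symm hk1.symm (t₀ := t) ?_)
    rintro ⟨s, hs⟩
    exact connectedComponentIn_subset _ _ (hkP s) hs
  refine ⟨P, hPo, h1P, fun h => h0P (hclos _ h hmem0), fun z hz => ?_⟩
  by_contra hne
  rw [hPo.frontier_eq] at hz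
  exact hz.2 (hclos z hz.1 hne)

theorem omegaLimitSet_subset_of_mem {X : Type*} [TopologicalSpace X] {f : X → X}
    (hf : Continuous f) {x c : X} (hc : c ∈ omegaLimitSet f x) :
    omegaLimitSet f c ⊆ omegaLimitSet f x := by
  have hstep : Set.MapsTo f (omegaLimitSet f x) (omegaLimitSet f x) := by
    intro y hy
    refine Set.mem_iInter.2 fun n => ?_
    refine map_mem_closure hf (Set.mem_iInter.1 hy n) ?_
    rintro _ ⟨k, hk, rfl⟩
    exact ⟨k + 1, by omega, Function.iterate_succ_apply' f k x⟩
  intro y hy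
  have hcl : IsClosed (omegaLimitSet f x) := isClosed_iInter fun n => isClosed_closure
  refine closure_minimal ?_ hcl (Set.mem_iInter.1 hy 0)
  rintro _ ⟨k, -, rfl⟩
  exact hstep.iterate k hc

/-- If transitive points meet the interior of every arc, then every closed set is separated from
any point outside it by an open set all of whose boundary points are transitive. -/
theorem exists_isOpen_frontier_transitive {D : Type*} [MetricSpace D] [CompactSpace D]
    [ConnectedSpace D] [LocallyConnectedSpace D] (hD : ¬ ∃ S : Set D, Nonempty (S ≃ₜ Circle))
    {f : D → D} (harc : ∀ γ : C(unitInterval, D), Function.Injective γ →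
      ∃ t : unitInterval, t ≠ 0 ∧ t ≠ 1 ∧ omegaLimitSet f (γ t) = Set.univ)
    {A : Set D} (hA : IsCompact A) {b : D} (hb : b ∉ A) :
    ∃ U : Set D, IsOpen U ∧ b ∈ U ∧ Disjoint A (closure U) ∧
      ∀ c ∈ frontier U, omegaLimitSet f c = Set.univ := by
  have := locallyPathConnectedSpace_of_compact_locallyConnected D
  have hpath : IsPathConnected (Set.univ : Set D) :=
    isOpen_univ.isConnected_iff_isPathConnected.1 isConnected_univ
  refine hA.induction_on
    (p := fun A => ∃ U : Set D, IsOpen U ∧ b ∈ U ∧ Disjoint A (closure U) ∧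
      ∀ c ∈ frontier U, omegaLimitSet f c = Set.univ)
    ⟨Set.univ, isOpen_univ, trivial, Set.empty_disjoint _, by simp⟩
    (fun s t hst ⟨U, hU, hbU, hd, hfr⟩ => ⟨U, hU, hbU, hd.mono_left hst, hfr⟩)
    (fun s t ⟨U, hU, hbU, hUd, hUf⟩ ⟨V, hV, hbV, hVd, hVf⟩ =>
      ⟨U ∩ V, hU.inter hV, ⟨hbU, hbV⟩, Set.disjoint_union_left.2
        ⟨hUd.mono_right (closure_mono Set.inter_subset_left),
          hVd.mono_right (closure_mono Set.inter_subset_right)⟩, fun c hc => ?_⟩)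
    fun a ha => ?_
  · rcases frontier_inter_subset U V hc with h | h
    · exact hUf c h.1
    · exact hVf c h.2
  · have hab : a ≠ b := fun e => hb (e ▸ ha)
    obtain ⟨g, hg, hg0, hg1, -⟩ := (hpath.joinedIn a trivial b trivial).exists_injective hab
    obtain ⟨t, ht0, ht1, ht⟩ := harc g hg
    obtain ⟨P, hP, h1P, h0P, hfr⟩ := exists_isOpen_frontier_subset_singleton hD hg ht0 ht1
    rw [hg0] at h0P
    rw [hg1] at h1P
    refine ⟨(closure P)ᶜ, mem_nhdsWithin_of_mem_nhds (isClosed_closure.isOpen_compl.mem_nhds h0P),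
      P, hP, h1P, disjoint_compl_left, fun c hc => ?_⟩
    rw [Set.mem_singleton_iff.1 (hfr hc), ht]

/-- Let `D` be a dendrite (a nontrivial compact connected locally connected metric
space containing no subset homeomorphic to the circle) and `f : D → D` continuous.
If every arc in `D` (the image of an injective continuous map `γ : [0,1] → D`,
with endpoints `γ 0 ≠ γ 1`) contains an interior point `c = γ t`, `t ∉ {0,1}`,
with `ω(c,f) = D`, then `ω(f)` is a totally disconnected subspace of `2^D`. -/
theorem omegaHyperspace_totallyDisconnected_of_dense_orbit_points
    {D : Type*} [MetricSpace D] [CompactSpace D] [ConnectedSpace D]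
    [LocallyConnectedSpace D] [Nontrivial D]
    (hD : ¬ ∃ S : Set D, Nonempty (S ≃ₜ Circle))
    (f : D → D) (hf : Continuous f)
    (harc : ∀ γ : C(unitInterval, D), Function.Injective γ →
      ∃ t : unitInterval, t ≠ 0 ∧ t ≠ 1 ∧ omegaLimitSet f (γ t) = Set.univ) :
    IsTotallyDisconnected (omegaHyperspace f) := by
  intro T hT hconn
  have hsub : ∀ A ∈ T, ∀ B ∈ T, (B : Set D) ⊆ A := by
    intro A hAT B hBT b hbB
    by_contra hbA
    obtain ⟨U, hU, hbU, hdisj, hfr⟩ :=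
      exists_isOpen_frontier_transitive hD harc A.isCompact hbA
    obtain ⟨C, -, ⟨z, hzC, hzU⟩, hC⟩ := hconn _ _
      (NonemptyCompacts.isOpen_inter_nonempty_of_isOpen hU)
      (NonemptyCompacts.isOpen_subsets_of_isOpen isClosed_closure.isOpen_compl)
      (fun C hCT => by
        by_cases hCU : ((C : Set D) ∩ U).Nonempty
        · exact Or.inl hCU
        refine Or.inr fun c hc hcU => hCU ?_
        obtain ⟨x, hx⟩ := hT hCT
        by_cases hcU' : c ∈ U
        · exact ⟨c, hc, hcU'⟩
        have hcf : c ∈ frontier U := hU.frontier_eq ▸ ⟨hcU, hcU'⟩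
        rw [hx] at hc ⊢
        exact ⟨b, omegaLimitSet_subset_of_mem hf hc (hfr c hcf ▸ trivial), hbU⟩)
      ⟨B, hBT, b, hbB, hbU⟩ ⟨A, hAT, Set.disjoint_left.1 hdisj⟩
    exact hC hzC (subset_closure hzU)
  intro A hA B hB
  exact SetLike.coe_injective (Set.Subset.antisymm (hsub B hB A hA) (hsub A hA B hB))
end

section
/- Let D be a dendrite whose set of end points E(D) is closed in D. If f : D → D is a continuous topologically transitive map, then the hyperspace of ω-limit sets ω(f) is a totally disconnected subspace of 2^D. -/
open TopologicalSpace Filter Topology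

/-- A map `f` is topologically transitive if for all nonempty open `U, V` there is
`n ∈ ℕ` (a positive integer) with `f^[n](U) ∩ V ≠ ∅`. -/
def TopTransitive {X : Type*} [TopologicalSpace X] (f : X → X) : Prop :=
  ∀ U V : Set X, IsOpen U → IsOpen V → U.Nonempty → V.Nonempty →
    ∃ n : ℕ, 0 < n ∧ ((f^[n] '' U) ∩ V).Nonempty

/-- The set of end points of a space: points `p` whose complement `D \ {p}`
is connected. -/
def endPoints (D : Type*) [TopologicalSpace D] : Set D :=
  {p : D | IsConnected ({p}ᶜ : Set D)}

section Components

variable {X : Type*} [TopologicalSpace X]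

theorem mem_connectedComponentIn_of_isPreconnected {s F : Set X} (hs : IsPreconnected s)
    (hsF : s ⊆ F) {x y : X} (hx : x ∈ s) (hy : y ∈ s) : y ∈ connectedComponentIn F x :=
  hs.subset_connectedComponentIn hx hsF hy

theorem mem_connectedComponentIn_symm {F : Set X} {x y : X}
    (h : y ∈ connectedComponentIn F x) : x ∈ connectedComponentIn F y := by
  rw [← connectedComponentIn_eq h]
  exact mem_connectedComponentIn (connectedComponentIn_nonempty_iff.mp ⟨y, h⟩)

theorem mem_connectedComponentIn_trans {F : Set X} {x y z : X}
    (h : y ∈ connectedComponentIn F x) (h' : z ∈ connectedComponentIn F y) :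
    z ∈ connectedComponentIn F x :=
  connectedComponentIn_eq h ▸ h'

variable [T1Space X] [LocallyConnectedSpace X]

theorem isOpen_connectedComponentIn_compl (p a : X) :
    IsOpen (connectedComponentIn {p}ᶜ a) :=
  isOpen_compl_singleton.connectedComponentIn

theorem closure_connectedComponentIn_compl_subset (p a : X) :
    closure (connectedComponentIn {p}ᶜ a) ⊆ insert p (connectedComponentIn {p}ᶜ a) := by
  intro w hw
  by_cases hwp : w = p
  · exact Or.inl hwp
  · obtain ⟨v, hv, hv'⟩ := mem_closure_iff.mp hw _ (isOpen_connectedComponentIn_compl p w)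
      (mem_connectedComponentIn hwp)
    exact Or.inr (mem_connectedComponentIn_trans hv' (mem_connectedComponentIn_symm hv))

variable [ConnectedSpace X]

theorem mem_closure_connectedComponentIn_compl {p a : X} (h : a ≠ p) :
    p ∈ closure (connectedComponentIn {p}ᶜ a) := by
  by_contra hp
  have ha : a ∈ connectedComponentIn {p}ᶜ a := mem_connectedComponentIn h
  have hcl : IsClosed (connectedComponentIn {p}ᶜ a) :=
    isClosed_of_closure_subset fun w hw =>
      (closure_connectedComponentIn_compl_subset p a hw).resolve_left
        (by rintro rfl; exact hp hw)
  have := IsClopen.eq_univ ⟨hcl, isOpen_connectedComponentIn_compl p a⟩ ⟨a, ha⟩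
  have hmem : p ∈ connectedComponentIn {p}ᶜ a := this ▸ Set.mem_univ p
  exact connectedComponentIn_subset _ _ hmem rfl

theorem isPreconnected_insert_connectedComponentIn_compl {p a : X} (h : a ≠ p) :
    IsPreconnected (insert p (connectedComponentIn {p}ᶜ a)) :=
  isPreconnected_connectedComponentIn.subset_closure (Set.subset_insert _ _)
    (Set.insert_subset (mem_closure_connectedComponentIn_compl h) subset_closure)

theorem isPreconnected_compl_connectedComponentIn_compl (p a : X) :
    IsPreconnected (connectedComponentIn {p}ᶜ a)ᶜ := by
  refine isPreconnected_of_forall p fun w hw => ?_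
  by_cases hwp : w = p
  · subst hwp
    exact ⟨{w}, by simpa using hw, rfl, rfl, isPreconnected_singleton⟩
  · refine ⟨_, ?_, Set.mem_insert _ _, Set.mem_insert_of_mem _ (mem_connectedComponentIn hwp),
      isPreconnected_insert_connectedComponentIn_compl hwp⟩
    refine Set.insert_subset (fun hp => connectedComponentIn_subset _ _ hp rfl)
      fun v hv hv' => hw ?_
    exact mem_connectedComponentIn_trans hv' (mem_connectedComponentIn_symm hv)

/-- A nonempty set with nonempty connected complement contains an end point. -/
theorem exists_endPoint_mem_of_isConnected_compl [CompactSpace X] {Q : Set X}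
    (hQ : Q.Nonempty) (hQc : IsConnected Qᶜ) : (endPoints X ∩ Q).Nonempty := by
  obtain ⟨r, hr⟩ := hQc.nonempty
  obtain ⟨q₀, hq₀⟩ := hQ
  let F : X → Set X := fun q => (connectedComponentIn {q}ᶜ r)ᶜ
  have hmem : ∀ q, q ∈ F q := fun q hq => connectedComponentIn_subset _ _ hq rfl
  have hclosed : ∀ q, IsClosed (F q) := fun q =>
    (isOpen_connectedComponentIn_compl q r).isClosed_compl
  have hmono : ∀ q q', r ≠ q → q' ∈ F q → F q' ⊆ F q := fun q q' hrq hq' =>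
    Set.compl_subset_compl.mpr <| isPreconnected_connectedComponentIn.subset_connectedComponentIn
      (mem_connectedComponentIn hrq) fun w hw => by rintro rfl; exact hq' hw
  have hFQ : F q₀ ⊆ Q := Set.compl_subset_comm.mpr <|
    hQc.isPreconnected.subset_connectedComponentIn hr fun w hw => by rintro rfl; exact hw hq₀
  have hrF : ∀ q, r ∈ F q → q = r := fun q hq => by
    by_contra h
    exact hq (mem_connectedComponentIn (Ne.symm h))
  have hr₀ : r ∉ F q₀ := fun h => hr (hFQ h)
  obtain ⟨M, hM₀, hM⟩ := zorn_superset_nonempty {s | ∃ q ∈ F q₀, s = F q} (by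
    intro c hc hchain hne
    have hn : (⋂₀ c).Nonempty := by
      refine IsCompact.nonempty_sInter_of_directed_nonempty_isCompact_isClosed
        (hS := hne.to_subtype) (fun s hs t ht => (hchain.total hs ht).elim
          (fun h => ⟨s, hs, subset_rfl, h⟩) fun h => ⟨t, ht, h, subset_rfl⟩) ?_ ?_ ?_
      · intro s hs
        obtain ⟨q, -, rfl⟩ := hc hs
        exact ⟨q, hmem q⟩
      · intro s hs
        obtain ⟨q, -, rfl⟩ := hc hs
        exact (hclosed q).isCompact
      · intro s hs
        obtain ⟨q, -, rfl⟩ := hc hs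
        exact hclosed q
    obtain ⟨z, hz⟩ := hn
    have key : ∀ s ∈ c, F z ⊆ s ∧ s ⊆ F q₀ := by
      intro s hs
      obtain ⟨q, hq, rfl⟩ := hc hs
      have hrq : r ≠ q := by rintro rfl; exact hr₀ hq
      exact ⟨hmono q z hrq (hz _ hs), hmono q₀ q (by rintro rfl; exact hr₀ (hmem _)) hq⟩
    obtain ⟨s, hs⟩ := hne
    exact ⟨F z, ⟨z, (key s hs).2 (hz s hs), rfl⟩, fun s hs => (key s hs).1⟩) (F q₀)
    ⟨q₀, hmem q₀, rfl⟩
  obtain ⟨⟨q, hq, rfl⟩, hmin⟩ := hM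
  have hrq : r ≠ q := by rintro rfl; exact hr₀ hq
  refine ⟨q, ?_, hFQ hq⟩
  have hsing : F q ⊆ {q} := by
    intro q' hq'
    by_contra hne
    have hne : q' ≠ q := hne
    have h1 : q' ∈ F q₀ := hmono q₀ q (by rintro rfl; exact hr₀ (hmem _)) hq hq'
    have h2 : F q ⊆ F q' := hmin ⟨q', h1, rfl⟩ (hmono q q' hrq hq')
    refine h2 (hmem q) ?_
    refine mem_connectedComponentIn_of_isPreconnected
      (isPreconnected_insert_connectedComponentIn_compl hrq) ?_
      (Set.mem_insert_of_mem _ (mem_connectedComponentIn hrq)) (Set.mem_insert _ _)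
    refine Set.insert_subset (Ne.symm hne) fun w hw => ?_
    rintro rfl
    exact hq' hw
  have : ({q}ᶜ : Set X) = connectedComponentIn {q}ᶜ r :=
    (Set.compl_subset_comm.mpr hsing).antisymm (connectedComponentIn_subset _ _)
  show IsConnected _
  rw [this]
  exact ⟨⟨r, mem_connectedComponentIn hrq⟩, isPreconnected_connectedComponentIn⟩

end Components

section Dynamics

theorem TopTransitive.exists_denseRange_iterate {X : Type*} [MetricSpace X] [CompactSpace X]
    {f : X → X} (hf : Continuous f) (htrans : TopTransitive f) {U : Set X} (hU : IsOpen U)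
    (hne : U.Nonempty) : ∃ z ∈ U, Dense (Set.range fun n : ℕ => f^[n] z) := by
  have hcount := countable_countableBasis X
  have : Dense (⋂ V ∈ countableBasis X, ⋃ n : ℕ, f^[n] ⁻¹' V) := by
    refine dense_biInter_of_isOpen (fun V hV => ?_) hcount fun V hV => ?_
    · exact isOpen_iUnion fun n =>
        (isOpen_of_mem_countableBasis hV).preimage (hf.iterate n)
    · refine dense_iff_inter_open.mpr fun W hW hWne => ?_
      obtain ⟨n, -, y, ⟨x, hx, rfl⟩, hy⟩ := htrans W V hW (isOpen_of_mem_countableBasis hV) hWne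
        (nonempty_of_mem_countableBasis hV)
      exact ⟨x, hx, Set.mem_iUnion.mpr ⟨n, hy⟩⟩
  obtain ⟨z, hzU, hz⟩ := this.inter_open_nonempty U hU hne
  refine ⟨z, hzU, (isBasis_countableBasis X).dense_iff.mpr fun V hV _ => ?_⟩
  obtain ⟨n, hn⟩ := Set.mem_iUnion.mp (Set.mem_iInter₂.mp hz V hV)
  exact ⟨_, hn, n, rfl⟩

theorem apply_mem_omegaLimitSet {X : Type*} [TopologicalSpace X] {f : X → X} (hf : Continuous f)
    {x z : X} (hz : z ∈ omegaLimitSet f x) : f z ∈ omegaLimitSet f x := by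
  refine Set.mem_iInter.mpr fun n => ?_
  refine map_mem_closure hf (Set.mem_iInter.mp hz n) ?_
  rintro _ ⟨k, hk, rfl⟩
  exact ⟨k + 1, by omega, Function.iterate_succ_apply' f k x⟩

theorem omegaLimitSet_eq_univ_of_dense {X : Type*} [TopologicalSpace X] {f : X → X}
    (hf : Continuous f) {x z : X} (hz : z ∈ omegaLimitSet f x)
    (hd : Dense (Set.range fun n : ℕ => f^[n] z)) : omegaLimitSet f x = Set.univ := by
  have hcl : IsClosed (omegaLimitSet f x) := isClosed_iInter fun _ => isClosed_closure
  refine Set.eq_univ_of_univ_subset ?_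
  rw [← hd.closure_eq]
  refine closure_minimal ?_ hcl
  rintro _ ⟨n, rfl⟩
  induction n with
  | zero => exact hz
  | succ n ih =>
    show f^[n + 1] z ∈ _
    rw [Function.iterate_succ_apply']
    exact apply_mem_omegaLimitSet hf ih

/-- If every point can be separated from every closed set missing it by an open set whose
frontier consists of points with dense orbit, then the hyperspace of ω-limit sets is totally
disconnected. -/
theorem isTotallyDisconnected_omegaHyperspace_of_frontier {X : Type*} [MetricSpace X]
    {f : X → X} (hf : Continuous f)
    (h : ∀ (x : X) (B : Set X), IsCompact B → x ∉ B → ∃ U : Set X, IsOpen U ∧ x ∈ U ∧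
      Disjoint (closure U) B ∧ ∀ z ∈ frontier U, Dense (Set.range fun n : ℕ => f^[n] z)) :
    IsTotallyDisconnected (omegaHyperspace f) := by
  intro t ht hconn
  have key : ∀ A ∈ t, ∀ B ∈ t, (A : Set X) ⊆ B := by
    intro A hA B hB x hxA
    by_contra hxB
    obtain ⟨U, hU, hxU, hUB, hfr⟩ := h x B B.isCompact hxB
    obtain ⟨C, hCt, hCU, hCU'⟩ := hconn _ _
      (NonemptyCompacts.isOpen_inter_nonempty_of_isOpen hU)
      (NonemptyCompacts.isOpen_subsets_of_isOpen (isClosed_closure (s := U)).isOpen_compl)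
      (fun C hC => by
        by_cases hdis : (C : Set X) ⊆ (closure U)ᶜ
        · exact Or.inr hdis
        · left
          obtain ⟨z, hzC, hz⟩ := Set.not_subset.mp hdis
          rw [Set.notMem_compl_iff] at hz
          by_cases hzU : z ∈ U
          · exact ⟨z, hzC, hzU⟩
          · obtain ⟨y, hy⟩ := ht hC
            have : (C : Set X) = Set.univ := by
              rw [hy] at hzC ⊢
              exact omegaLimitSet_eq_univ_of_dense hf hzC
                (hfr z ⟨hz, by rwa [hU.interior_eq]⟩)
            exact ⟨x, by rw [this]; trivial, hxU⟩)
      ⟨A, hA, x, hxA, hxU⟩ ⟨B, hB, hUB.symm.subset_compl_right⟩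
    obtain ⟨z, hzC, hzU⟩ := hCU
    exact hCU' hzC (subset_closure hzU)
  intro A hA B hB
  exact SetLike.coe_injective ((key A hA B hB).antisymm (key B hB A hA))

end Dynamics

section Separation

variable {X : Type*} [TopologicalSpace X]

theorem eventually_mem_connectedComponentIn_compl [T2Space X] [LocallyPathConnectedSpace X]
    {p a b : X} (h : b ∈ connectedComponentIn {p}ᶜ a) :
    ∀ᶠ p' in 𝓝 p, b ∈ connectedComponentIn {p'}ᶜ a := by
  have ha : a ∈ ({p}ᶜ : Set X) := connectedComponentIn_nonempty_iff.mp ⟨b, h⟩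
  have hpath : IsPathConnected (connectedComponentIn {p}ᶜ a) :=
    (isOpen_connectedComponentIn_compl p a).isConnected_iff_isPathConnected.mp
      ⟨⟨b, h⟩, isPreconnected_connectedComponentIn⟩
  obtain ⟨γ, hγ⟩ := hpath.joinedIn a (mem_connectedComponentIn ha) b h
  have hp : p ∈ (Set.range γ)ᶜ := by
    rintro ⟨t, rfl⟩
    exact connectedComponentIn_subset _ _ (hγ t) rfl
  filter_upwards [(isCompact_range γ.continuous).isClosed.isOpen_compl.mem_nhds hp] with p' hp'
  refine mem_connectedComponentIn_of_isPreconnected (isPreconnected_range γ.continuous)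
    (fun w hw => ?_) ⟨0, γ.source⟩ ⟨1, γ.target⟩
  rintro rfl
  exact hp' hw

/-- An arc in a space, parametrised by the unit interval and such that every interior point
separates its two ends. -/
structure IsSeparatingArc (α : ℝ → X) : Prop where
  continuous : Continuous α
  injOn : Set.InjOn α (Set.Icc 0 1)
  separates : ∀ t ∈ Set.Ioo (0 : ℝ) 1, α 1 ∉ connectedComponentIn {α t}ᶜ (α 0)

namespace IsSeparatingArc

variable {α : ℝ → X}

theorem mem_left (hα : IsSeparatingArc α) {u s : ℝ} (hu : 0 ≤ u) (hus : u < s) (hs : s ≤ 1) :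
    α u ∈ connectedComponentIn {α s}ᶜ (α 0) := by
  refine mem_connectedComponentIn_of_isPreconnected
    (isPreconnected_Icc.image α hα.continuous.continuousOn : IsPreconnected (α '' Set.Icc 0 u))
    ?_ ⟨0, ⟨le_rfl, hu⟩, rfl⟩ ⟨u, ⟨hu, le_rfl⟩, rfl⟩
  rintro _ ⟨v, ⟨hv0, hv⟩, rfl⟩ h
  have := hα.injOn ⟨hv0, by linarith⟩ ⟨by linarith, hs⟩ h
  linarith

theorem mem_right (hα : IsSeparatingArc α) {u s : ℝ} (hu : u ≤ 1) (hus : s < u) (hs : 0 ≤ s) :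
    α u ∈ connectedComponentIn {α s}ᶜ (α 1) := by
  refine mem_connectedComponentIn_of_isPreconnected
    (isPreconnected_Icc.image α hα.continuous.continuousOn : IsPreconnected (α '' Set.Icc u 1))
    ?_ ⟨1, ⟨hu, le_rfl⟩, rfl⟩ ⟨u, ⟨le_rfl, hu⟩, rfl⟩
  rintro _ ⟨v, ⟨hv0, hv⟩, rfl⟩ h
  have := hα.injOn ⟨by linarith, hv⟩ ⟨hs, by linarith⟩ h
  linarith

/-- The parameters of the points of an arc having a complementary component which avoids both
ends of the arc. -/
def branchParams (α : ℝ → X) : Set ℝ :=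
  {s | s ∈ Set.Ioo (0 : ℝ) 1 ∧ ∃ q, q ≠ α s ∧ q ∉ connectedComponentIn {α s}ᶜ (α 0) ∧
    q ∉ connectedComponentIn {α s}ᶜ (α 1)}

theorem exists_isOpen_of_disjoint_branchParams [T2Space X] [LocallyPathConnectedSpace X]
    (hα : IsSeparatingArc α) {a b : ℝ} (hab : a < b) (ha : 0 < a) (hb : b < 1)
    (hdis : ∀ s ∈ Set.Icc a b, s ∉ branchParams α) :
    ∃ O : Set X, IsOpen O ∧ O.Nonempty ∧ O ⊆ α '' Set.Ioo 0 1 := by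
  refine ⟨connectedComponentIn {α a}ᶜ (α 1) ∩ connectedComponentIn {α b}ᶜ (α 0),
    (isOpen_connectedComponentIn_compl _ _).inter (isOpen_connectedComponentIn_compl _ _),
    ⟨α ((a + b) / 2), hα.mem_right (by linarith) (by linarith) ha.le,
      hα.mem_left (by linarith) (by linarith) hb.le⟩, ?_⟩
  rintro w ⟨hwa, hwb⟩
  have hmem : w ∈ α '' Set.Icc a b := by
    by_contra hw
    have hcover : Set.Icc a b ⊆ {u | w ∈ connectedComponentIn {α u}ᶜ (α 0)} ∪
        {u | w ∈ connectedComponentIn {α u}ᶜ (α 1)} := by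
      intro u hu
      by_contra hcon
      simp only [Set.mem_union, Set.mem_ofPred_eq, not_or] at hcon
      exact hdis u hu ⟨⟨by linarith [hu.1], by linarith [hu.2]⟩, w,
        fun h => hw ⟨u, hu, h.symm⟩, hcon⟩
    have hopen : ∀ c, IsOpen {u : ℝ | w ∈ connectedComponentIn {α u}ᶜ c} := fun c =>
      isOpen_iff_mem_nhds.mpr fun u hu =>
        hα.continuous.continuousAt.eventually (eventually_mem_connectedComponentIn_compl hu)
    obtain ⟨u, hu, hu0, hu1⟩ := isPreconnected_Icc _ _ (hopen _) (hopen _) hcover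
      ⟨b, ⟨hab.le, le_rfl⟩, hwb⟩ ⟨a, ⟨le_rfl, hab.le⟩, hwa⟩
    exact hα.separates u ⟨by linarith [hu.1], by linarith [hu.2]⟩
      (mem_connectedComponentIn_trans hu0 (mem_connectedComponentIn_symm hu1))
  exact Set.image_mono (Set.Icc_subset_Ioo ha hb) hmem

variable [T2Space X] [ConnectedSpace X] [LocallyConnectedSpace X]

theorem exists_endPoint_of_mem_branchParams [CompactSpace X] {s : ℝ} (hs : s ∈ branchParams α) :
    ∃ e ∈ endPoints X, e ≠ α s ∧ e ∉ connectedComponentIn {α s}ᶜ (α 0) ∧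
      e ∉ connectedComponentIn {α s}ᶜ (α 1) := by
  obtain ⟨hs01, q, hq, hq0, hq1⟩ := hs
  obtain ⟨e, he, heq⟩ := exists_endPoint_mem_of_isConnected_compl
    (Q := connectedComponentIn {α s}ᶜ q) ⟨q, mem_connectedComponentIn hq⟩
    ⟨⟨α 0, fun h => hq0 (mem_connectedComponentIn_symm h)⟩,
      isPreconnected_compl_connectedComponentIn_compl _ _⟩
  have heq' := mem_connectedComponentIn_symm heq
  exact ⟨e, he, connectedComponentIn_subset _ _ heq,
    fun h => hq0 (mem_connectedComponentIn_trans h heq'),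
    fun h => hq1 (mem_connectedComponentIn_trans h heq')⟩

theorem notMem_connectedComponentIn_of_ne (hα : IsSeparatingArc α) {s s' : ℝ}
    (hs : s ∈ Set.Ioo (0 : ℝ) 1) (hs' : s' ∈ Set.Ioo (0 : ℝ) 1) (hne : s ≠ s') {e e' : X}
    (he0 : e ∉ connectedComponentIn {α s}ᶜ (α 0)) (he1 : e ∉ connectedComponentIn {α s}ᶜ (α 1))
    (he' : e' ≠ α s') (he0' : e' ∉ connectedComponentIn {α s'}ᶜ (α 0))
    (he1' : e' ∉ connectedComponentIn {α s'}ᶜ (α 1)) :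
    e' ∉ connectedComponentIn {α s}ᶜ e := by
  intro h
  have side : ∀ u ∈ Set.Ioo (0 : ℝ) 1, ∀ v ∈ Set.Ioo (0 : ℝ) 1, u ≠ v →
      α v ∈ connectedComponentIn {α u}ᶜ (α 0) ∨ α v ∈ connectedComponentIn {α u}ᶜ (α 1) := by
    intro u hu v hv huv
    rcases lt_or_gt_of_ne huv with huv | huv
    · exact Or.inr (hα.mem_right hv.2.le huv hu.1.le)
    · exact Or.inl (hα.mem_left hv.1.le huv hu.2.le)
  have hr : α s ≠ α s' := fun h => hne (hα.injOn ⟨hs.1.le, hs.2.le⟩ ⟨hs'.1.le, hs'.2.le⟩ h)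
  have hr' : α s ∉ connectedComponentIn {α s'}ᶜ e' := fun hmem => by
    have hmem := mem_connectedComponentIn_symm hmem
    rcases side s' hs' s hs hne.symm with h0 | h1
    · exact he0' (mem_connectedComponentIn_trans h0 hmem)
    · exact he1' (mem_connectedComponentIn_trans h1 hmem)
  have hjoin : e' ∈ connectedComponentIn {α s}ᶜ (α s') := by
    refine mem_connectedComponentIn_of_isPreconnected
      (isPreconnected_insert_connectedComponentIn_compl he') ?_ (Set.mem_insert _ _)
      (Set.mem_insert_of_mem _ (mem_connectedComponentIn he'))
    refine Set.insert_subset hr.symm fun w hw => ?_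
    rintro rfl
    exact hr' hw
  have hjoin := mem_connectedComponentIn_trans hjoin (mem_connectedComponentIn_symm h)
  rcases side s hs s' hs' hne with h0 | h1
  · exact he0 (mem_connectedComponentIn_trans h0 hjoin)
  · exact he1 (mem_connectedComponentIn_trans h1 hjoin)

end IsSeparatingArc

theorem IsSeparatingArc.exists_isOpen_subset {X : Type*} [MetricSpace X] [CompactSpace X]
    [ConnectedSpace X] [LocallyPathConnectedSpace X] {α : ℝ → X} (hα : IsSeparatingArc α)
    (hE : IsClosed (endPoints X)) :
    ∃ O : Set X, IsOpen O ∧ O.Nonempty ∧ O ⊆ α '' Set.Ioo 0 1 := by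
  by_cases hT : ∃ a b : ℝ, a < b ∧ 0 < a ∧ b < 1 ∧ ∀ s ∈ Set.Icc a b, s ∉ branchParams α
  · obtain ⟨a, b, hab, ha, hb, h⟩ := hT
    exact hα.exists_isOpen_of_disjoint_branchParams hab ha hb h
  exfalso
  push Not at hT
  have hex : ∀ n : ℕ, ∃ s e, (1 / 2 < s ∧ s ≤ 1 / 2 + 1 / ((n : ℝ) + 3)) ∧
      s ∈ Set.Ioo (0 : ℝ) 1 ∧ e ∈ endPoints X ∧ e ≠ α s ∧
      e ∉ connectedComponentIn {α s}ᶜ (α 0) ∧ e ∉ connectedComponentIn {α s}ᶜ (α 1) := by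
    intro n
    have hpos : (0 : ℝ) < 1 / ((n : ℝ) + 3) := by positivity
    have hlt : 1 / ((n : ℝ) + 3) ≤ 1 / 3 :=
      one_div_le_one_div_of_le (by norm_num) (by linarith [n.cast_nonneg (α := ℝ)])
    obtain ⟨s, hs, hsT⟩ := hT (1 / 2 + 1 / ((n : ℝ) + 3) / 2) (1 / 2 + 1 / ((n : ℝ) + 3))
      (by linarith) (by linarith) (by linarith)
    obtain ⟨e, he⟩ := exists_endPoint_of_mem_branchParams hsT
    exact ⟨s, e, ⟨by linarith [hs.1], hs.2⟩, hsT.1, he⟩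
  choose s e hs hs01 heE hes he0 he1 using hex
  obtain ⟨p, hpE, φ, hφ, hlim⟩ := hE.isCompact.tendsto_subseq heE
  have hslim : Tendsto (s ∘ φ) atTop (𝓝 (1 / 2)) := by
    refine Tendsto.comp ?_ hφ.tendsto_atTop
    refine tendsto_of_tendsto_of_tendsto_of_le_of_le tendsto_const_nhds ?_
      (fun n => (hs n).1.le) (fun n => (hs n).2)
    have : Tendsto (fun n : ℕ => 1 / ((n : ℝ) + 3)) atTop (𝓝 0) := by
      simp only [one_div]
      exact tendsto_inv_atTop_zero.comp
        (tendsto_atTop_add_const_right _ _ tendsto_natCast_atTop_atTop)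
    have h := this.const_add (1 / 2 : ℝ)
    rwa [add_zero] at h
  have hpz : p ≠ α (1 / 2) := by
    rintro rfl
    refine hα.separates (1 / 2) (by norm_num) ?_
    refine mem_connectedComponentIn_of_isPreconnected
      (show IsConnected _ from hpE).isPreconnected subset_rfl (fun h => ?_) (fun h => ?_)
    · have := hα.injOn (by norm_num) (by norm_num) h
      norm_num at this
    · have := hα.injOn (by norm_num) (by norm_num) h
      norm_num at this
  obtain ⟨U, W, hU, hW, hpU, hzW, hUW⟩ := t2_separation hpz
  obtain ⟨V, hVU, hV, hpV, hVc⟩ := locallyConnectedSpace_iff_subsets_isOpen_isConnected.mp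
    inferInstance p U (hU.mem_nhds hpU)
  have h1 : ∀ᶠ n in atTop, e (φ n) ∈ V := hlim.eventually (hV.mem_nhds hpV)
  have h2 : ∀ᶠ n in atTop, α (s (φ n)) ∈ W :=
    ((hα.continuous.tendsto _).comp hslim).eventually (hW.mem_nhds hzW)
  obtain ⟨n, hnV, hnW⟩ := (h1.and h2).exists
  obtain ⟨m, hmV, hms⟩ := (h1.and (hslim.eventually (gt_mem_nhds (hs (φ n)).1))).exists
  refine hα.notMem_connectedComponentIn_of_ne (hs01 (φ n)) (hs01 (φ m)) (ne_of_gt hms)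
    (he0 _) (he1 _) (hes _) (he0 _) (he1 _) ?_
  refine mem_connectedComponentIn_of_isPreconnected hVc.isPreconnected (fun w hw => ?_) hnV hmV
  rintro rfl
  exact hUW.ne_of_mem (hVU hw) hnW rfl

/-- If any two points are separated by a point of `T`, then any point is separated from any
compact set missing it by an open set with frontier in `T`. -/
theorem exists_isOpen_frontier_subset [T2Space X] [LocallyConnectedSpace X] {T : Set X}
    (hT : ∀ x y : X, x ≠ y → ∃ p ∈ T, p ≠ x ∧ p ≠ y ∧ y ∉ connectedComponentIn {p}ᶜ x)
    {x : X} {B : Set X} (hB : IsCompact B) (hx : x ∉ B) :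
    ∃ U : Set X, IsOpen U ∧ x ∈ U ∧ Disjoint (closure U) B ∧ frontier U ⊆ T := by
  refine hB.induction_on (p := fun s => ∃ U : Set X, IsOpen U ∧ x ∈ U ∧
    Disjoint (closure U) s ∧ frontier U ⊆ T) ?_ ?_ ?_ ?_
  · exact ⟨Set.univ, isOpen_univ, trivial, by simp, by simp⟩
  · rintro s t hst ⟨U, hU, hxU, hUt, hUT⟩
    exact ⟨U, hU, hxU, hUt.mono_right hst, hUT⟩
  · rintro s t ⟨U, hU, hxU, hUs, hUT⟩ ⟨V, hV, hxV, hVt, hVT⟩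
    refine ⟨U ∩ V, hU.inter hV, ⟨hxU, hxV⟩, Set.disjoint_union_right.mpr
      ⟨hUs.mono_left (closure_mono Set.inter_subset_left),
        hVt.mono_left (closure_mono Set.inter_subset_right)⟩, fun z hz => ?_⟩
    rcases frontier_inter_subset U V hz with h | h
    · exact hUT h.1
    · exact hVT h.2
  · intro y hy
    obtain ⟨p, hpT, hpx, hpy, hsep⟩ := hT x y (by rintro rfl; exact hx hy)
    have hdis : Disjoint (connectedComponentIn {p}ᶜ x) (connectedComponentIn {p}ᶜ y) :=
      Set.disjoint_left.mpr fun w hw hw' =>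
        hsep (mem_connectedComponentIn_trans hw (mem_connectedComponentIn_symm hw'))
    have hopen := fun a => isOpen_connectedComponentIn_compl p a
    refine ⟨connectedComponentIn {p}ᶜ y, mem_nhdsWithin_of_mem_nhds
      ((hopen y).mem_nhds (mem_connectedComponentIn hpy.symm)),
      connectedComponentIn {p}ᶜ x, hopen x, mem_connectedComponentIn hpx.symm,
        hdis.closure_left (hopen y), fun z hz => ?_⟩
    rcases closure_connectedComponentIn_compl_subset p x hz.1 with rfl | h
    · exact hpT
    · exact absurd ((hopen x).interior_eq.symm ▸ h) hz.2

end Separation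

section LocalPaths

variable {X : Type*} [MetricSpace X]

theorem IsPreconnected.exists_chain {V : Set X} (hV : IsPreconnected V) {x y : X} (hx : x ∈ V)
    (hy : y ∈ V) {δ : ℝ} (hδ : 0 < δ) :
    ∃ c : ℕ → X, c 0 = x ∧ (∀ᶠ i in atTop, c i = y) ∧ (∀ i, c i ∈ V) ∧
      ∀ i, dist (c i) (c (i + 1)) < δ := by
  have hchain : Relation.ReflTransGen (fun a b => a ∈ V ∧ b ∈ V ∧ dist a b < δ) x y := by
    refine hV.induction₂ (fun a b => Relation.ReflTransGen
      (fun a b => a ∈ V ∧ b ∈ V ∧ dist a b < δ) a b) ?_ ?_ ?_ hx hy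
    · intro a ha
      filter_upwards [self_mem_nhdsWithin, mem_nhdsWithin_of_mem_nhds (Metric.ball_mem_nhds a hδ)]
        with b hb hab
      exact Relation.ReflTransGen.single ⟨ha, hb, by rwa [dist_comm]⟩
    · exact fun a b c _ _ _ hab hbc => hab.trans hbc
    · intro a b _ _ hab
      refine Relation.ReflTransGen.mono (fun c d h => ⟨h.2.1, h.1, ?_⟩) _ _
        (Relation.ReflTransGen.swap _ _ hab)
      rw [dist_comm]
      exact h.2.2
  clear hx
  induction hchain using Relation.ReflTransGen.head_induction_on with
  | refl => exact ⟨fun _ => y, rfl, by simp, fun _ => hy, by simpa using hδ⟩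
  | @head a b hab _ ih =>
    obtain ⟨c, hc0, hcy, hcV, hc⟩ := ih
    refine ⟨fun i => Nat.casesOn i a c, rfl, ?_, ?_, ?_⟩
    · obtain ⟨n, hn⟩ := eventually_atTop.mp hcy
      refine eventually_atTop.mpr ⟨n + 1, ?_⟩
      rintro (_ | i) hi
      · omega
      · exact hn i (by omega)
    · rintro (_ | i)
      exacts [hab.1, hcV i]
    · rintro (_ | i)
      · simpa [hc0] using hab.2.2
      · exact hc i

theorem exists_isPreconnected_subset_ball [CompactSpace X] [LocallyConnectedSpace X] {ε : ℝ}
    (hε : 0 < ε) : ∃ δ > 0, ∀ x y : X, dist x y < δ →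
      ∃ V : Set X, IsPreconnected V ∧ x ∈ V ∧ y ∈ V ∧ V ⊆ Metric.ball x ε := by
  obtain ⟨δ, hδ, h⟩ := lebesgue_number_lemma_of_metric_sUnion (isCompact_univ (X := X))
    (c := {V | IsOpen V ∧ IsPreconnected V ∧ ∀ a ∈ V, ∀ b ∈ V, dist a b < ε})
    (fun V hV => hV.1) (fun x _ => by
      obtain ⟨V, hVb, hV, hxV, hVc⟩ := locallyConnectedSpace_iff_subsets_isOpen_isConnected.mp
        inferInstance x _ (Metric.ball_mem_nhds x (half_pos hε))
      refine ⟨V, ⟨hV, hVc.isPreconnected, fun a ha b hb => ?_⟩, hxV⟩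
      have h1 := Metric.mem_ball.mp (hVb ha)
      have h2 := Metric.mem_ball.mp (hVb hb)
      linarith [dist_triangle_right a b x])
  refine ⟨δ, hδ, fun x y hxy => ?_⟩
  obtain ⟨V, ⟨-, hV, hVε⟩, hb⟩ := h x trivial
  have hxV := hb (Metric.mem_ball_self hδ)
  exact ⟨V, hV, hxV, hb (by rwa [Metric.mem_ball, dist_comm]), fun y hy => hVε y hy x hxV⟩

/-- A sequence of points going from `a` to `b` in at most `p.1` jumps of length less than `δ`. -/
structure IsFineChain (a b : X) (δ : ℝ) (p : ℕ × (ℕ → X)) : Prop where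
  pos : 0 < p.1
  source : p.2 0 = a
  target : ∀ i, p.1 ≤ i → p.2 i = b
  dist_lt : ∀ i, dist (p.2 i) (p.2 (i + 1)) < δ

theorem IsFineChain.exists_refinement {a b : X} {δ δ' ε : ℝ} (hδ' : 0 < δ') (hε : 0 < ε)
    (hδ : ∀ x y : X, dist x y < δ →
      ∃ V : Set X, IsPreconnected V ∧ x ∈ V ∧ y ∈ V ∧ V ⊆ Metric.ball x ε)
    {p : ℕ × (ℕ → X)} (hp : IsFineChain a b δ p) :
    ∃ q, IsFineChain a b δ' q ∧ ∃ M, 0 < M ∧ q.1 = p.1 * M ∧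
      ∀ m, dist (p.2 (m / M)) (q.2 m) < ε := by
  have hex : ∀ i, ∃ (c : ℕ → X) (m : ℕ), c 0 = p.2 i ∧ (∀ j ≥ m, c j = p.2 (i + 1)) ∧
      (∀ j, dist (p.2 i) (c j) < ε) ∧ ∀ j, dist (c j) (c (j + 1)) < δ' := by
    intro i
    obtain ⟨V, hV, hx, hy, hb⟩ := hδ _ _ (hp.dist_lt i)
    obtain ⟨c, hc0, hcy, hcV, hc⟩ := hV.exists_chain hx hy hδ'
    obtain ⟨m, hm⟩ := eventually_atTop.mp hcy
    exact ⟨c, m, hc0, hm, fun j => Metric.mem_ball'.mp (hb (hcV j)), hc⟩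
  choose c m hc0 hm hcε hcδ using hex
  let c' : ℕ → ℕ → X := fun i j => if i < p.1 then c i j else b
  let M : ℕ := (Finset.range p.1).sup m + 1
  have hc'0 : ∀ i, c' i 0 = p.2 i := by
    intro i
    by_cases hi : i < p.1
    · simp [c', hi, hc0]
    · simp [c', hi, hp.target i (not_lt.mp hi)]
  have hc'M : ∀ i, c' i M = p.2 (i + 1) := by
    intro i
    by_cases hi : i < p.1
    · simp only [c', hi, if_true]
      exact hm i M ((Finset.le_sup (f := m) (Finset.mem_range.mpr hi)).trans (Nat.le_succ _))
    · simp [c', hi, hp.target (i + 1) (by omega)]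
  have hc'ε : ∀ i j, dist (p.2 i) (c' i j) < ε := by
    intro i j
    by_cases hi : i < p.1
    · simpa [c', hi] using hcε i j
    · simpa [c', hi, hp.target i (not_lt.mp hi)] using hε
  have hc'δ : ∀ i j, dist (c' i j) (c' i (j + 1)) < δ' := by
    intro i j
    by_cases hi : i < p.1
    · simpa [c', hi] using hcδ i j
    · simpa [c', hi] using hδ'
  have hM : 0 < M := Nat.succ_pos _
  refine ⟨(p.1 * M, fun k => c' (k / M) (k % M)), ⟨Nat.mul_pos hp.pos hM, ?_, ?_, ?_⟩, M, hM, rfl,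
    fun k => hc'ε _ _⟩
  · simp [hc'0, hp.source]
  · intro k hk
    have : ¬ k / M < p.1 := not_lt.mpr ((Nat.le_div_iff_mul_le hM).mpr hk)
    simp [c', this]
  · intro k
    show dist (c' (k / M) (k % M)) (c' ((k + 1) / M) ((k + 1) % M)) < δ'
    have hj := Nat.mod_lt k hM
    obtain ⟨i, j, hi, hj'⟩ : ∃ i j, k / M = i ∧ k % M = j := ⟨_, _, rfl, rfl⟩
    have hk : k + 1 = j + 1 + M * i := by rw [← Nat.mod_add_div k M, hi, hj']; ring
    rw [hi, hj', hk, Nat.add_mul_div_left _ _ hM, Nat.add_mul_mod_self_left]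
    rw [hj'] at hj
    rcases Nat.lt_or_ge (j + 1) M with h | h
    · rw [Nat.div_eq_of_lt h, Nat.mod_eq_of_lt h, zero_add]
      exact hc'δ i j
    · have h : j + 1 = M := by omega
      have := hc'δ i j
      rw [h, hc'M] at this
      rwa [h, Nat.div_self hM, Nat.mod_self, hc'0, add_comm]

theorem exists_path_subset_closedBall [CompactSpace X] [LocallyConnectedSpace X] {ε : ℝ}
    (hε : 0 < ε) : ∃ δ > 0, ∀ a b : X, dist a b < δ →
      JoinedIn (Metric.closedBall a (2 * ε)) a b := by
  let η : ℕ → ℝ := fun k => ε / 2 / 2 ^ k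
  have hη : ∀ k, 0 < η k := fun k => by positivity
  choose δ₀ hδ₀ hlc using fun k => exists_isPreconnected_subset_ball (X := X) (hη k)
  let δ : ℕ → ℝ := fun k => min (δ₀ k) (η k)
  have hδ : ∀ k, 0 < δ k := fun k => lt_min (hδ₀ k) (hη k)
  refine ⟨δ 0, hδ 0, fun a b hab => ?_⟩
  have hstep : ∀ k (p : {p : ℕ × (ℕ → X) // IsFineChain a b (δ k) p}),
      ∃ q : {q : ℕ × (ℕ → X) // IsFineChain a b (δ (k + 1)) q}, ∃ M, 0 < M ∧
        q.1.1 = p.1.1 * M ∧ ∀ m, dist (p.1.2 (m / M)) (q.1.2 m) < η k := by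
    intro k p
    obtain ⟨q, hq, h⟩ := p.2.exists_refinement (hδ (k + 1)) (hη k)
      fun x y hxy => hlc k x y (hxy.trans_le (min_le_left _ _))
    exact ⟨⟨q, hq⟩, h⟩
  choose next hnext using hstep
  let p₀ : {p : ℕ × (ℕ → X) // IsFineChain a b (δ 0) p} :=
    ⟨(1, fun i => if i = 0 then a else b), one_pos, rfl,
      fun i (hi : 1 ≤ i) => if_neg (by omega), by
        rintro (_ | i)
        · simpa using hab
        · simpa using hδ 0⟩
  let s : ∀ k, {p : ℕ × (ℕ → X) // IsFineChain a b (δ k) p} := fun k => Nat.rec p₀ next k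
  have hs : ∀ k, ∃ M, 0 < M ∧ (s (k + 1)).1.1 = (s k).1.1 * M ∧
      ∀ m, dist ((s k).1.2 (m / M)) ((s (k + 1)).1.2 m) < η k := fun k => hnext k (s k)
  let F : ℕ → ℝ → X := fun k t => (s k).1.2 ⌊(s k).1.1 * t⌋₊
  have hF : ∀ t k, dist (F k t) (F (k + 1) t) ≤ ε / 2 / 2 ^ k := by
    intro t k
    obtain ⟨M, hM, hN, hd⟩ := hs k
    have hfl : ⌊((s k).1.1 : ℝ) * t⌋₊ = ⌊((s (k + 1)).1.1 : ℝ) * t⌋₊ / M := by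
      rw [← Nat.floor_div_natCast, hN]
      have : (M : ℝ) ≠ 0 := by exact_mod_cast hM.ne'
      congr 1
      push_cast
      field_simp
    have := hd ⌊((s (k + 1)).1.1 : ℝ) * t⌋₊
    rw [← hfl] at this
    exact this.le
  choose f hf using fun t => cauchySeq_tendsto_of_complete
    (cauchySeq_of_le_geometric_two (hF t))
  have hdist : ∀ t k, dist (F k t) (f t) ≤ ε / 2 ^ k := fun t k =>
    dist_le_of_le_geometric_two_of_tendsto (hF t) (hf t) k
  have hjump : ∀ k m n : ℕ, m ≤ n + 1 → n ≤ m + 1 →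
      dist ((s k).1.2 m) ((s k).1.2 n) ≤ ε / 2 ^ k := by
    have hle : ∀ k, δ k ≤ ε / 2 ^ k := fun k => (min_le_right _ _).trans (by
      show ε / 2 / 2 ^ k ≤ ε / 2 ^ k
      gcongr
      linarith)
    intro k m n hmn hnm
    rcases lt_trichotomy m n with h | rfl | h
    · obtain rfl : n = m + 1 := by omega
      exact ((s k).2.dist_lt m).le.trans (hle k)
    · rw [dist_self]; positivity
    · obtain rfl : m = n + 1 := by omega
      rw [dist_comm]
      exact ((s k).2.dist_lt n).le.trans (hle k)
  have hcont : Continuous f := by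
    refine Metric.continuous_iff.mpr fun t r hr => ?_
    obtain ⟨k, hk⟩ : ∃ k : ℕ, 3 * (ε / 2 ^ k) < r := by
      have : Tendsto (fun k : ℕ => 3 * (ε / 2 ^ k)) atTop (𝓝 0) := by
        have h := (tendsto_pow_atTop_nhds_zero_of_lt_one (r := (1 / 2 : ℝ)) (by norm_num)
          (by norm_num)).const_mul (3 * ε)
        simpa [mul_assoc, div_eq_mul_inv] using h
      exact (this.eventually (gt_mem_nhds hr)).exists
    have hN : (0 : ℝ) < (s k).1.1 := by exact_mod_cast (s k).2.pos
    refine ⟨1 / (s k).1.1, by positivity, fun u hu => ?_⟩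
    have habs : |((s k).1.1 : ℝ) * u - (s k).1.1 * t| < 1 := by
      rw [← mul_sub, abs_mul, abs_of_pos hN]
      rwa [Real.dist_eq, lt_div_iff₀ hN, mul_comm] at hu
    have hfl : ∀ v w : ℝ, |v - w| < 1 → ⌊v⌋₊ ≤ ⌊w⌋₊ + 1 := by
      intro v w h
      refine Nat.lt_add_one_iff.mp ((Nat.floor_lt' (by omega)).mpr ?_)
      have h1 := Nat.lt_floor_add_one w
      have h2 := (abs_lt.mp h).2
      push_cast
      linarith
    have h1 := hjump k _ _ (hfl _ _ habs) (hfl _ _ (by rwa [abs_sub_comm]))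
    have h2 := hdist u k
    have h3 := hdist t k
    calc dist (f u) (f t) ≤ dist (f u) (F k u) + dist (F k u) (F k t) + dist (F k t) (f t) :=
          dist_triangle4 _ _ _ _
      _ ≤ ε / 2 ^ k + ε / 2 ^ k + ε / 2 ^ k := by
          rw [dist_comm (f u)]
          exact add_le_add_three h2 h1 h3
      _ < r := by linarith
  have hf0 : f 0 = a := tendsto_nhds_unique (hf 0) (by simp [F, (s _).2.source])
  have hf1 : f 1 = b := tendsto_nhds_unique (hf 1) (by simp [F, (s _).2.target _ le_rfl])
  refine (JoinedIn.ofLine hcont.continuousOn hf0 hf1 ?_)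
  rintro _ ⟨t, -, rfl⟩
  have h1 := hdist t 0
  have h2 : dist (F 0 t) a ≤ ε := by
    show dist (if ⌊((1 : ℕ) : ℝ) * t⌋₊ = 0 then a else b) a ≤ ε
    split_ifs
    · rw [dist_self]; exact hε.le
    · rw [dist_comm]
      refine hab.le.trans ((min_le_right _ _).trans ?_)
      simp [η]; linarith
  rw [Metric.mem_closedBall]
  rw [pow_zero, div_one, dist_comm] at h1
  linarith [dist_triangle (f t) (F 0 t) a]

/-- A locally connected compact metric space is locally path connected. -/
theorem locallyPathConnectedSpace_of_locallyConnectedSpace [CompactSpace X]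
    [LocallyConnectedSpace X] : LocallyPathConnectedSpace X := by
  refine locallyPathConnectedSpace_iff_pathComponentIn_mem_nhds.mpr fun x u hu hx => ?_
  obtain ⟨r, hr, hru⟩ := Metric.nhds_basis_closedBall.mem_iff.mp (hu.mem_nhds hx)
  obtain ⟨δ, hδ, h⟩ := exists_path_subset_closedBall (X := X) (half_pos hr)
  filter_upwards [Metric.ball_mem_nhds x hδ] with y hy
  refine (h x y (Metric.mem_ball'.mp hy)).mono ?_
  rwa [mul_div_cancel₀ _ two_ne_zero]

end LocalPaths

section Arcs

variable {X : Type*}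

/-- Closed sets of parameters such that the path `γ` takes the same value at both ends of every
gap of the set. -/
structure IsShortcut (γ : ℝ → X) (C : Set ℝ) : Prop where
  isClosed : IsClosed C
  subset : C ⊆ Set.Icc 0 1
  zero_mem : (0 : ℝ) ∈ C
  one_mem : (1 : ℝ) ∈ C
  gap : ∀ a ∈ C, ∀ b ∈ C, a < b → Disjoint (Set.Ioo a b) C → γ a = γ b

theorem IsShortcut.sInter_of_isChain [MetricSpace X] {γ : ℝ → X} (hγ : Continuous γ)
    {c : Set (Set ℝ)} (hc : ∀ C ∈ c, IsShortcut γ C) (hchain : IsChain (· ⊆ ·) c) (hne : c.Nonempty) :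
    IsShortcut γ (⋂₀ c) := by
  obtain ⟨C₀, hC₀⟩ := hne
  refine ⟨isClosed_sInter fun C hC => (hc C hC).isClosed,
    (Set.sInter_subset_of_mem hC₀).trans (hc C₀ hC₀).subset, fun C hC => (hc C hC).zero_mem,
    fun C hC => (hc C hC).one_mem, fun a ha b hb hab hdis => ?_⟩
  by_contra hne
  have hev : ∀ᶠ p : ℝ × ℝ in 𝓝 (a, b), γ p.1 ≠ γ p.2 :=
    (isOpen_ne_fun (hγ.comp continuous_fst) (hγ.comp continuous_snd)).mem_nhds hne
  obtain ⟨η, hη, hball⟩ := Metric.eventually_nhds_iff.mp hev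
  obtain ⟨ε, hε, hεη, hεab⟩ : ∃ ε > 0, ε < η ∧ ε < (b - a) / 2 :=
    ⟨min η ((b - a) / 2) / 2, by have := lt_min hη (half_pos (sub_pos.mpr hab)); linarith,
      by have := lt_min hη (half_pos (sub_pos.mpr hab)); linarith [min_le_left η ((b - a) / 2)],
      by have := lt_min hη (half_pos (sub_pos.mpr hab)); linarith [min_le_right η ((b - a) / 2)]⟩
  obtain ⟨C, hC, hCK⟩ : ∃ C ∈ c, Disjoint (Set.Icc (a + ε) (b - ε)) C := by
    by_contra! hcon
    have : (⋂₀ ((fun C => Set.Icc (a + ε) (b - ε) ∩ C) '' c)).Nonempty := by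
      refine IsCompact.nonempty_sInter_of_directed_nonempty_isCompact_isClosed
        (hS := (Set.Nonempty.image _ ⟨C₀, hC₀⟩).to_subtype) ?_ ?_ ?_ ?_
      · rintro _ ⟨s, hs, rfl⟩ _ ⟨t, ht, rfl⟩
        rcases hchain.total hs ht with h | h
        · exact ⟨_, ⟨s, hs, rfl⟩, subset_rfl, Set.inter_subset_inter_right _ h⟩
        · exact ⟨_, ⟨t, ht, rfl⟩, Set.inter_subset_inter_right _ h, subset_rfl⟩
      · rintro _ ⟨s, hs, rfl⟩
        exact Set.not_disjoint_iff_nonempty_inter.mp (hcon s hs)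
      · rintro _ ⟨s, hs, rfl⟩
        exact isCompact_Icc.inter_right (hc s hs).isClosed
      · rintro _ ⟨s, hs, rfl⟩
        exact isClosed_Icc.inter (hc s hs).isClosed
    obtain ⟨z, hz⟩ := this
    have hzI : z ∈ Set.Icc (a + ε) (b - ε) := (hz _ ⟨C₀, hC₀, rfl⟩).1
    exact Set.disjoint_left.mp hdis ⟨by linarith [hzI.1], by linarith [hzI.2]⟩
      fun C hC => (hz _ ⟨C, hC, rfl⟩).2
  have hCc := (hc C hC).isClosed
  obtain ⟨a', ⟨⟨haa', ha'm⟩, ha'C⟩, ha'max⟩ :=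
    (isCompact_Icc.inter_right hCc : IsCompact (Set.Icc a ((a + b) / 2) ∩ C)).exists_isGreatest
      ⟨a, ⟨le_rfl, by linarith⟩, ha C hC⟩
  obtain ⟨b', ⟨⟨hb'm, hbb'⟩, hb'C⟩, hb'min⟩ :=
    (isCompact_Icc.inter_right hCc : IsCompact (Set.Icc ((a + b) / 2) b ∩ C)).exists_isLeast
      ⟨b, ⟨by linarith, le_rfl⟩, hb C hC⟩
  have hfree : ∀ z ∈ C, a + ε ≤ z → z ≤ b - ε → False := fun z hz h1 h2 =>
    Set.disjoint_left.mp hCK ⟨h1, h2⟩ hz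
  have ha'lt : a' < a + ε := by
    by_contra! h
    exact hfree a' ha'C h (by linarith)
  have hb'lt : b - ε < b' := by
    by_contra! h
    exact hfree b' hb'C (by linarith) h
  refine hball (y := (a', b')) ?_ ((hc C hC).gap a' ha'C b' hb'C (by linarith) ?_)
  · rw [Prod.dist_eq, Real.dist_eq, Real.dist_eq]
    exact max_lt (abs_lt.mpr ⟨by linarith, by linarith⟩) (abs_lt.mpr ⟨by linarith, by linarith⟩)
  · refine Set.disjoint_left.mpr fun z hz hzC => ?_
    rcases le_total z ((a + b) / 2) with h | h
    · exact absurd (ha'max ⟨⟨by linarith [hz.1], h⟩, hzC⟩) (not_le.mpr hz.1)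
    · exact absurd (hb'min ⟨⟨h, by linarith [hz.2]⟩, hzC⟩) (not_le.mpr hz.2)

theorem IsShortcut.diff_Ioo {γ : ℝ → X} {C : Set ℝ} (hC : IsShortcut γ C) {a b : ℝ} (ha : a ∈ C)
    (hb : b ∈ C) (hab : γ a = γ b) : IsShortcut γ (C \ Set.Ioo a b) := by
  have ha01 := hC.subset ha
  have hb01 := hC.subset hb
  refine ⟨hC.isClosed.sdiff isOpen_Ioo, Set.sdiff_subset.trans hC.subset,
    ⟨hC.zero_mem, fun h => absurd h.1 (not_lt.mpr ha01.1)⟩,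
    ⟨hC.one_mem, fun h => absurd h.2 (not_lt.mpr hb01.2)⟩, ?_⟩
  rintro a' ⟨ha'C, ha'⟩ b' ⟨hb'C, hb'⟩ hlt hdis
  by_cases h : Disjoint (Set.Ioo a' b') C
  · exact hC.gap a' ha'C b' hb'C hlt h
  obtain ⟨c, hc, hcC⟩ := Set.not_disjoint_iff.mp h
  have hcI : c ∈ Set.Ioo a b := by
    by_contra hcI
    exact Set.disjoint_left.mp hdis hc ⟨hcC, hcI⟩
  have h1 : a' ≤ a := by
    by_contra! h1
    exact ha' ⟨h1, hc.1.trans hcI.2⟩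
  have h2 : b ≤ b' := by
    by_contra! h2
    exact hb' ⟨hcI.1.trans hc.2, h2⟩
  have h3 : a' = a := by
    refine h1.antisymm (not_lt.mp fun h3 => ?_)
    exact Set.disjoint_left.mp hdis ⟨h3, hcI.1.trans hc.2⟩ ⟨ha, fun h => lt_irrefl _ h.1⟩
  have h4 : b' = b := by
    refine le_antisymm (not_lt.mp fun h4 => ?_) h2
    exact Set.disjoint_left.mp hdis ⟨hc.1.trans hcI.2, h4⟩ ⟨hb, fun h => lt_irrefl _ h.2⟩
  rw [h3, h4, hab]

theorem exists_isShortcut_gaps [MetricSpace X] {γ : ℝ → X} (hγ : Continuous γ) :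
    ∃ C, IsShortcut γ C ∧ ∀ a ∈ C, ∀ b ∈ C, γ a = γ b → Disjoint (Set.Ioo a b) C := by
  have h01 : IsShortcut γ (Set.Icc 0 1) :=
    ⟨isClosed_Icc, subset_rfl, by simp, by simp, fun a ha b hb hab hdis => by
      have h := Set.disjoint_left.mp hdis
        (show (a + b) / 2 ∈ Set.Ioo a b from ⟨by linarith, by linarith⟩)
      exact absurd ⟨by linarith [ha.1], by linarith [hb.2]⟩ h⟩
  obtain ⟨C, -, hC⟩ := zorn_superset_nonempty {C | IsShortcut γ C}
    (fun c hc hchain hne => ⟨⋂₀ c, IsShortcut.sInter_of_isChain hγ hc hchain hne,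
      fun s hs => Set.sInter_subset_of_mem hs⟩) (Set.Icc 0 1) h01
  refine ⟨C, hC.prop, fun a ha b hb hab => ?_⟩
  have : C ⊆ C \ Set.Ioo a b := hC.le_of_le (hC.prop.diff_Ioo ha hb hab) Set.sdiff_subset
  exact Set.disjoint_right.mpr fun z hz => (this hz).2

end Arcs

section ArcOfPath

variable {X : Type*} [MetricSpace X]

/-- The largest distance from `γ q` reached by `γ` on the part of `C` between `q` and `t`. -/
noncomputable def maxDist (γ : ℝ → X) (C : Set ℝ) (q t : ℝ) : ℝ :=
  sSup ((fun c => dist (γ q) (γ (max q (min c t)))) '' C)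

section maxDist

variable {γ : ℝ → X} {C : Set ℝ}

theorem continuous_maxDist (hγ : Continuous γ) (hC : IsCompact C)
    (q : ℝ) : Continuous (maxDist γ C q) :=
  hC.continuous_sSup (f := fun t c => dist (γ q) (γ (max q (min c t)))) (by fun_prop)

theorem bddAbove_maxDist (hγ : Continuous γ) (hC : IsCompact C)
    (q t : ℝ) :
    BddAbove ((fun c => dist (γ q) (γ (max q (min c t)))) '' C) :=
  hC.bddAbove_image (by fun_prop)

theorem maxDist_nonneg (q t : ℝ) : 0 ≤ maxDist γ C q t :=
  Real.sSup_nonneg (by rintro _ ⟨c, -, rfl⟩; exact dist_nonneg)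

theorem maxDist_mono (hγ : Continuous γ) (hC : IsCompact C)
    (q : ℝ) (hne : C.Nonempty) {s t : ℝ} (hs : s ∈ C) (hst : s ≤ t) :
    maxDist γ C q s ≤ maxDist γ C q t := by
  refine csSup_le_csSup (bddAbove_maxDist hγ hC q t) (hne.image _) ?_
  rintro _ ⟨c, hc, rfl⟩
  refine ⟨min c s, ?_, ?_⟩
  · rcases min_choice c s with h | h <;> rw [h] <;> assumption
  · simp only [min_assoc, min_eq_left hst]

theorem maxDist_eq_zero {q s : ℝ} (hsq : s ≤ q) : maxDist γ C q s = 0 := by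
  refine le_antisymm (Real.sSup_nonpos ?_) (maxDist_nonneg q s)
  rintro _ ⟨c, -, rfl⟩
  simp only [max_eq_left ((min_le_right c s).trans hsq), dist_self, le_refl]

theorem dist_le_maxDist (hγ : Continuous γ) (hC : IsCompact C)
    {q t : ℝ} (ht : t ∈ C) (hqt : q ≤ t) :
    dist (γ q) (γ t) ≤ maxDist γ C q t :=
  le_csSup (bddAbove_maxDist hγ hC q t) ⟨t, ht, by simp only [min_self, max_eq_right hqt]⟩

theorem maxDist_congr {q s t : ℝ} (hq : q ∈ C) (hst : s ≤ t) (hγst : γ s = γ t)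
    (hdis : Disjoint (Set.Ioo s t) C) : maxDist γ C q s = maxDist γ C q t := by
  have key : ∀ c ∈ C, c ≤ s ∨ t ≤ c := fun c hc => by
    by_contra! h
    exact Set.disjoint_left.mp hdis h hc
  refine congrArg sSup (Set.image_congr fun c hc => ?_)
  rcases key c hc with h | h
  · simp only [min_eq_left h, min_eq_left (h.trans hst)]
  · rw [min_eq_right h, min_eq_right (hst.trans h)]
    rcases key q hq with h' | h'
    · rw [max_eq_right h', max_eq_right (h'.trans hst), hγst]
    · rw [max_eq_left h', max_eq_left (hst.trans h')]

end maxDist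

theorem exists_continuous_strictMono_on_shortcut {γ : ℝ → X} {C : Set ℝ} (hγ : Continuous γ)
    (hC : IsShortcut γ C) (hmin : ∀ a ∈ C, ∀ b ∈ C, γ a = γ b → Disjoint (Set.Ioo a b) C) :
    ∃ h : ℝ → ℝ, Continuous h ∧ (∀ s ∈ C, ∀ t ∈ C, s ≤ t → γ s = γ t → h s = h t) ∧
      ∀ s ∈ C, ∀ t ∈ C, s < t → γ s ≠ γ t → h s < h t := by
  have hcpt : IsCompact C := isCompact_Icc.of_isClosed_subset hC.isClosed hC.subset
  have hne : C.Nonempty := ⟨0, hC.zero_mem⟩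
  have hπ : ∀ n : ℕ, ∃ q, IsGreatest (C ∩ Set.Iic (max (denseSeq ℝ n) 0)) q := fun n =>
    (hcpt.inter_right isClosed_Iic).exists_isGreatest
      ⟨0, hC.zero_mem, Set.mem_Iic.mpr (le_max_right _ _)⟩
  choose q hq using hπ
  have hqC : ∀ n, q n ∈ C := fun n => (hq n).1.1
  obtain ⟨M, hM⟩ : ∃ M, ∀ n t, maxDist γ C (q n) t ≤ M := by
    obtain ⟨M, hM⟩ := Metric.isBounded_iff.mp
      ((isCompact_Icc (a := (0:ℝ)) (b := 1)).image hγ).isBounded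
    refine ⟨M, fun n t => csSup_le (hne.image _) ?_⟩
    rintro _ ⟨c, hc, rfl⟩
    have h1 := hC.subset (hqC n)
    have h2 := hC.subset hc
    exact hM ⟨_, h1, rfl⟩ ⟨_, ⟨h1.1.trans (le_max_left _ _),
      max_le h1.2 ((min_le_left _ _).trans h2.2)⟩, rfl⟩
  have hsumM : Summable fun n : ℕ => (1 / 2 : ℝ) ^ n * M := summable_geometric_two.mul_right M
  have hle : ∀ t n, (1 / 2 : ℝ) ^ n * maxDist γ C (q n) t ≤ (1 / 2 : ℝ) ^ n * M := fun t n =>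
    mul_le_mul_of_nonneg_left (hM n t) (by positivity)
  have hnn : ∀ t n, 0 ≤ (1 / 2 : ℝ) ^ n * maxDist γ C (q n) t := fun t n =>
    mul_nonneg (by positivity) (maxDist_nonneg _ _)
  have hsum : ∀ t, Summable fun n : ℕ => (1 / 2 : ℝ) ^ n * maxDist γ C (q n) t := fun t =>
    hsumM.of_nonneg_of_le (hnn t) (hle t)
  refine ⟨fun t => ∑' n : ℕ, (1 / 2 : ℝ) ^ n * maxDist γ C (q n) t, ?_, ?_, ?_⟩
  · refine continuous_tsum (fun n => (continuous_maxDist hγ hcpt (q n)).const_mul _) hsumM ?_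
    intro n t
    rw [Real.norm_of_nonneg (hnn t n)]
    exact hle t n
  · intro s hs t ht hst hγst
    exact tsum_congr fun n => by rw [maxDist_congr (hqC n) hst hγst (hmin s hs t ht hγst)]
  · intro s hs t ht hst hγst
    obtain ⟨n, hsn, hnt, hγn⟩ : ∃ n, s ≤ q n ∧ q n ≤ t ∧ γ (q n) ≠ γ t := by
      obtain ⟨ε, hε, hball⟩ := Metric.eventually_nhds_iff.mp
        (((isOpen_ne_fun hγ (continuous_const (y := γ t))).mem_nhds hγst : ∀ᶠ z in 𝓝 s, γ z ≠ γ t))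
      obtain ⟨n, hn⟩ := (denseRange_denseSeq ℝ).exists_mem_open
        (isOpen_Ioo (a := s) (b := min t (s + ε))) (Set.nonempty_Ioo.mpr (lt_min hst (by linarith)))
      obtain ⟨hn1, hn2⟩ := hn
      obtain ⟨hn2, hn3⟩ := lt_min_iff.mp hn2
      have h0 : 0 ≤ denseSeq ℝ n := (hC.subset hs).1.trans hn1.le
      have hle : q n ≤ denseSeq ℝ n :=
        (Set.mem_Iic.mp (hq n).1.2).trans_eq (max_eq_left h0)
      have hge : s ≤ q n := (hq n).2 ⟨hs, hn1.le.trans (le_max_left _ _)⟩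
      refine ⟨n, hge, hle.trans hn2.le, hball ?_⟩
      rw [Real.dist_eq, abs_of_nonneg (by linarith)]
      linarith
    refine Summable.tsum_lt_tsum (i := n) (fun m => ?_) ?_ (hsum s) (hsum t)
    · exact mul_le_mul_of_nonneg_left (maxDist_mono hγ hcpt _ hne hs hst.le) (by positivity)
    · rw [maxDist_eq_zero hsn]
      exact mul_lt_mul_of_pos_left ((dist_pos.mpr hγn).trans_le (dist_le_maxDist hγ hcpt ht hnt))
        (by positivity)

theorem exists_arc_of_path {γ : ℝ → X} (hγ : Continuous γ) (h01 : γ 0 ≠ γ 1) :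
    ∃ α : ℝ → X, Continuous α ∧ Set.InjOn α (Set.Icc 0 1) ∧ α 0 = γ 0 ∧ α 1 = γ 1 ∧
      ∀ t, α t ∈ γ '' Set.Icc 0 1 := by
  obtain ⟨C, hC, hmin⟩ := exists_isShortcut_gaps hγ
  obtain ⟨h, hh, heq, hlt⟩ := exists_continuous_strictMono_on_shortcut hγ hC hmin
  have hcpt : IsCompact C := isCompact_Icc.of_isClosed_subset hC.isClosed hC.subset
  have hmono : ∀ s ∈ C, ∀ t ∈ C, s ≤ t → h s ≤ h t := fun s hs t ht hst => by
    by_cases hγst : γ s = γ t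
    · exact (heq s hs t ht hst hγst).le
    · exact (hlt s hs t ht (hst.lt_of_ne fun h => hγst (h ▸ rfl)) hγst).le
  have hiff : ∀ s ∈ C, ∀ t ∈ C, h s = h t → γ s = γ t := fun s hs t ht hst => by
    by_contra hne
    rcases lt_trichotomy s t with h' | h' | h'
    · exact (hlt s hs t ht h' hne).ne hst
    · exact hne (h' ▸ rfl)
    · exact (hlt t ht s hs h' (Ne.symm hne)).ne hst.symm
  have hiff' : ∀ s ∈ C, ∀ t ∈ C, γ s = γ t → h s = h t := fun s hs t ht hst => by
    rcases le_total s t with h' | h'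
    · exact heq s hs t ht h' hst
    · exact (heq t ht s hs h' hst.symm).symm
  have hlt01 : h 0 < h 1 := hlt 0 hC.zero_mem 1 hC.one_mem one_pos h01
  have hsurj : ∀ v ∈ Set.Icc (h 0) (h 1), ∃ c ∈ C, h c = v := by
    intro v hv
    by_contra! hcon
    obtain ⟨a, ⟨haC, hav⟩, hamax⟩ :=
      (hcpt.inter_right (isClosed_Iic.preimage hh) :
        IsCompact (C ∩ h ⁻¹' Set.Iic v)).exists_isGreatest
        ⟨0, hC.zero_mem, hv.1⟩
    obtain ⟨b, ⟨hbC, hbv⟩, hbmin⟩ :=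
      (hcpt.inter_right (isClosed_Ici.preimage hh) :
        IsCompact (C ∩ h ⁻¹' Set.Ici v)).exists_isLeast
        ⟨1, hC.one_mem, hv.2⟩
    have hav : h a < v := lt_of_le_of_ne hav (hcon a haC)
    have hbv : v < h b := lt_of_le_of_ne hbv (hcon b hbC).symm
    have hab : a < b := by
      by_contra! hba
      exact absurd (hmono b hbC a haC hba) (by linarith)
    have := hC.gap a haC b hbC hab (Set.disjoint_left.mpr fun z hz hzC => by
      rcases le_total (h z) v with h' | h'
      · exact absurd (hamax ⟨hzC, h'⟩) (not_le.mpr hz.1)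
      · exact absurd (hbmin ⟨hzC, h'⟩) (not_le.mpr hz.2))
    exact absurd (hiff' a haC b hbC this) (by linarith)
  have hbd : ∀ c ∈ C, h c ∈ Set.Icc (h 0) (h 1) := fun c hc =>
    ⟨hmono 0 hC.zero_mem c hc (hC.subset hc).1, hmono c hc 1 hC.one_mem (hC.subset hc).2⟩
  let φ : C → Set.Icc (h 0) (h 1) := fun c => ⟨h c, hbd c c.2⟩
  have hφ : Continuous φ := by fun_prop
  have hφs : Function.Surjective φ := fun v => by
    obtain ⟨c, hc, hcv⟩ := hsurj v v.2
    exact ⟨⟨c, hc⟩, Subtype.ext hcv⟩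
  have : CompactSpace C := isCompact_iff_compactSpace.mp hcpt
  let β : Set.Icc (h 0) (h 1) → X := fun u => γ ((Function.surjInv hφs u : C) : ℝ)
  have hβφ : ∀ c : C, β (φ c) = γ c := fun c =>
    hiff _ (Subtype.prop _) _ c.2 (congrArg Subtype.val (Function.surjInv_eq hφs (φ c)))
  have hβ : Continuous β := by
    rw [(hφ.isClosedMap.isQuotientMap hφ hφs).continuous_iff]
    exact (hγ.comp continuous_subtype_val).congr fun c => (hβφ c).symm
  have hβinj : Function.Injective β := fun u v huv => by
    obtain ⟨c, rfl⟩ := hφs u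
    obtain ⟨d, rfl⟩ := hφs v
    rw [hβφ, hβφ] at huv
    exact Subtype.ext (hiff' c c.2 d d.2 huv)
  have hval : ∀ t ∈ Set.Icc (0 : ℝ) 1,
      (Set.projIcc (h 0) (h 1) hlt01.le (h 0 + t * (h 1 - h 0)) : ℝ) =
      h 0 + t * (h 1 - h 0) := fun t ht => by
    rw [Set.projIcc_of_mem _ (show h 0 + t * (h 1 - h 0) ∈ Set.Icc (h 0) (h 1) from
      ⟨by nlinarith [ht.1], by nlinarith [ht.2]⟩)]
  refine ⟨fun t => β (Set.projIcc (h 0) (h 1) hlt01.le (h 0 + t * (h 1 - h 0))), ?_, ?_, ?_, ?_, ?_⟩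
  · exact hβ.comp (continuous_projIcc.comp (by fun_prop))
  · intro s hs t ht hst
    have := congrArg Subtype.val (hβinj hst)
    rw [hval s hs, hval t ht] at this
    exact mul_right_cancel₀ (sub_pos.mpr hlt01).ne' (add_left_cancel this)
  · refine (congrArg β (Subtype.ext ?_)).trans (hβφ ⟨0, hC.zero_mem⟩)
    rw [hval 0 (by simp)]
    simp [φ]
  · refine (congrArg β (Subtype.ext ?_)).trans (hβφ ⟨1, hC.one_mem⟩)
    rw [hval 1 (by simp)]
    simp [φ]
  · exact fun t => ⟨_, hC.subset (Subtype.prop _), rfl⟩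

end ArcOfPath

section Circles

variable {X : Type*} [MetricSpace X]

theorem nonempty_homeomorph_circle_of_loop {F : ℝ → X} (hF : Continuous F) {p : ℝ} (hp : 0 < p)
    (hF0 : F 0 = F p) (hinj : Set.InjOn F (Set.Ico 0 p)) :
    ∃ S : Set X, Nonempty (S ≃ₜ Circle) := by
  have : Fact (0 < p) := ⟨hp⟩
  have hc : Continuous (AddCircle.liftIco p 0 F) :=
    AddCircle.liftIco_continuous (by rwa [zero_add]) hF.continuousOn
  have hi : Function.Injective (AddCircle.liftIco p 0 F) := by
    have hrep : ∀ u : AddCircle p, ∃ x ∈ Set.Ico 0 (0 + p), (x : AddCircle p) = u := fun u =>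
      ⟨_, (AddCircle.equivIco p 0 u).2, AddCircle.coe_equivIco⟩
    intro u v huv
    obtain ⟨x, hx, rfl⟩ := hrep u
    obtain ⟨y, hy, rfl⟩ := hrep v
    rw [AddCircle.liftIco_coe_apply hx, AddCircle.liftIco_coe_apply hy] at huv
    rw [zero_add] at hx hy
    rw [hinj hx hy huv]
  exact ⟨Set.range (AddCircle.liftIco p 0 F),
    ⟨(hc.isClosedEmbedding hi).isEmbedding.toHomeomorph.symm.trans
      (AddCircle.homeomorphCircle hp.ne')⟩⟩

theorem nonempty_homeomorph_circle_of_arcs {α β : ℝ → X} (hα : Continuous α)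
    (hαi : Set.InjOn α (Set.Icc 0 1)) (hβ : Continuous β) (hβi : Set.InjOn β (Set.Icc 0 1))
    (h0 : α 0 = β 0) (h1 : α 1 = β 1) {t₀ : ℝ} (ht₀ : t₀ ∈ Set.Ioo (0 : ℝ) 1)
    (hαt : α t₀ ∉ β '' Set.Icc 0 1) : ∃ S : Set X, Nonempty (S ≃ₜ Circle) := by
  have hcl : IsClosed (α ⁻¹' (β '' Set.Icc 0 1)) :=
    (isCompact_Icc.image hβ).isClosed.preimage hα
  obtain ⟨a, ⟨⟨ha0, hat⟩, u, hu, hua⟩, hamax⟩ :=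
    (isCompact_Icc.inter_right hcl : IsCompact (Set.Icc 0 t₀ ∩ _)).exists_isGreatest
      ⟨0, ⟨le_rfl, ht₀.1.le⟩, 0, by simp, h0.symm⟩
  obtain ⟨b, ⟨⟨hbt, hb1⟩, v, hv, hvb⟩, hbmin⟩ :=
    (isCompact_Icc.inter_right hcl : IsCompact (Set.Icc t₀ 1 ∩ _)).exists_isLeast
      ⟨1, ⟨ht₀.2.le, le_rfl⟩, 1, by simp, h1.symm⟩
  have hat : a < t₀ := hat.lt_of_ne fun h => hαt ⟨u, hu, by rw [hua, h]⟩
  have hbt : t₀ < b := hbt.lt_of_ne fun h => hαt ⟨v, hv, by rw [hvb, ← h]⟩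
  have hfree : ∀ s, a < s → s < b → ∀ w ∈ Set.Icc (0 : ℝ) 1, β w ≠ α s := by
    intro s has hsb w hw hws
    rcases le_total s t₀ with h | h
    · exact absurd (hamax ⟨⟨by linarith, h⟩, w, hw, hws⟩) (not_le.mpr has)
    · exact absurd (hbmin ⟨⟨h, by linarith⟩, w, hw, hws⟩) (not_le.mpr hsb)
  have ha01 : a ∈ Set.Icc (0 : ℝ) 1 := ⟨ha0, by linarith [ht₀.2]⟩
  have hb01 : b ∈ Set.Icc (0 : ℝ) 1 := ⟨by linarith [ht₀.1], hb1⟩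
  have huv : u ≠ v := fun h => by
    have := hαi ha01 hb01 (by rw [← hua, ← hvb, h])
    linarith
  have hσ : ∀ t ∈ Set.Icc (0 : ℝ) 1, a + (b - a) * t ∈ Set.Icc (0 : ℝ) 1 := fun t ht =>
    ⟨by nlinarith [ht.1], by nlinarith [ht.2]⟩
  have hυ : ∀ t ∈ Set.Icc (1 : ℝ) 2, v + (u - v) * (t - 1) ∈ Set.Icc (0 : ℝ) 1 := fun t ht =>
    ⟨by nlinarith [ht.1, ht.2, hu.1, hv.1, mul_nonneg hu.1 (sub_nonneg.mpr ht.1),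
      mul_nonneg hv.1 (sub_nonneg.mpr ht.2)],
     by nlinarith [ht.1, ht.2, mul_nonneg (sub_nonneg.mpr hu.2) (sub_nonneg.mpr ht.1),
      mul_nonneg (sub_nonneg.mpr hv.2) (sub_nonneg.mpr ht.2)]⟩
  let F : ℝ → X := fun t => if t ≤ 1 then α (a + (b - a) * t) else β (v + (u - v) * (t - 1))
  have hF1 : ∀ t, t ≤ 1 → F t = α (a + (b - a) * t) := fun t ht => if_pos ht
  have hF2 : ∀ t, 1 < t → F t = β (v + (u - v) * (t - 1)) := fun t ht => if_neg (not_le.mpr ht)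
  have hmix : ∀ s t, 0 ≤ s → s ≤ 1 → 1 < t → t < 2 → F s ≠ F t := by
    intro s t hs0 hs1 ht1 ht2 hst
    rw [hF1 s hs1, hF2 t ht1] at hst
    have hw := hυ t ⟨ht1.le, ht2.le⟩
    rcases hs0.eq_or_lt with rfl | hs0
    · rw [mul_zero, add_zero, ← hua] at hst
      have := hβi hu hw hst
      have : (u - v) * (2 - t) = 0 := by linarith
      rcases mul_eq_zero.mp this with h | h
      · exact huv (sub_eq_zero.mp h)
      · linarith
    rcases hs1.eq_or_lt with rfl | hs1
    · rw [mul_one, add_sub_cancel, ← hvb] at hst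
      have := hβi hv hw hst
      have : (u - v) * (t - 1) = 0 := by linarith
      rcases mul_eq_zero.mp this with h | h
      · exact huv (sub_eq_zero.mp h)
      · linarith
    exact hfree _ (by nlinarith) (by nlinarith) _ hw hst.symm
  refine nonempty_homeomorph_circle_of_loop (F := F) (p := 2) ?_ two_pos ?_ ?_
  · refine Continuous.if_le (by fun_prop) (by fun_prop) continuous_id continuous_const ?_
    intro t ht
    obtain rfl : t = 1 := ht
    rw [mul_one, add_sub_cancel, sub_self, mul_zero, add_zero, hvb]
  · rw [hF1 0 zero_le_one, hF2 2 one_lt_two, mul_zero, add_zero, ← hua]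
    congr 1
    ring
  · intro s hs t ht hst
    rcases le_or_gt s 1 with hs1 | hs1 <;> rcases le_or_gt t 1 with ht1 | ht1
    · rw [hF1 s hs1, hF1 t ht1] at hst
      have := hαi (hσ s ⟨hs.1, hs1⟩) (hσ t ⟨ht.1, ht1⟩) hst
      exact mul_left_cancel₀ (sub_pos.mpr (hat.trans hbt)).ne' (add_left_cancel this)
    · exact absurd hst (hmix s t hs.1 hs1 ht1 ht.2)
    · exact absurd hst.symm (hmix t s ht.1 ht1 hs1 hs.2)
    · rw [hF2 s hs1, hF2 t ht1] at hst
      have := hβi (hυ s ⟨hs1.le, hs.2.le⟩) (hυ t ⟨ht1.le, ht.2.le⟩) hst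
      have := mul_left_cancel₀ (sub_ne_zero.mpr huv) (add_left_cancel this)
      linarith

theorem isSeparatingArc_of_injOn [LocallyPathConnectedSpace X]
    (hX : ¬ ∃ S : Set X, Nonempty (S ≃ₜ Circle)) {α : ℝ → X} (hα : Continuous α)
    (hαi : Set.InjOn α (Set.Icc 0 1)) : IsSeparatingArc α := by
  refine ⟨hα, hαi, fun t ht hmem => hX ?_⟩
  have h01 : α 0 ≠ α 1 := fun h => zero_ne_one (hαi (by simp) (by simp) h)
  have h0 : α 0 ∈ ({α t}ᶜ : Set X) := fun h =>
    ht.1.ne (hαi (by simp) ⟨ht.1.le, ht.2.le⟩ h)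
  have hpc : IsPathConnected (connectedComponentIn {α t}ᶜ (α 0)) := by
    rw [← IsOpen.isConnected_iff_isPathConnected (isOpen_compl_singleton.connectedComponentIn)]
    exact isConnected_connectedComponentIn_iff.mpr h0
  obtain ⟨γ, hγ⟩ := hpc.joinedIn _ (mem_connectedComponentIn h0) _ hmem
  obtain ⟨β, hβ, hβi, hβ0, hβ1, hβγ⟩ := exists_arc_of_path (γ := γ.extend) γ.continuous_extend
    (by simpa using h01)
  refine nonempty_homeomorph_circle_of_arcs hα hαi hβ hβi (by simpa using hβ0.symm)
    (by simpa using hβ1.symm) ht ?_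
  rintro ⟨s, -, hs⟩
  obtain ⟨r, hr, hrs⟩ := hβγ s
  rw [γ.extend_apply hr] at hrs
  exact connectedComponentIn_subset _ _ (hγ ⟨r, hr⟩) (hrs.trans hs)

end Circles

/-- Let `D` be a dendrite (a nontrivial compact connected locally connected metric
space containing no subset homeomorphic to the circle) whose set of end points is
closed in `D`.  If `f : D → D` is a continuous topologically transitive map, then
`ω(f)` is a totally disconnected subspace of `2^D`. -/
theorem omegaHyperspace_totallyDisconnected_of_closed_endPoints
    {D : Type*} [MetricSpace D] [CompactSpace D] [ConnectedSpace D]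
    [LocallyConnectedSpace D] [Nontrivial D]
    (hD : ¬ ∃ S : Set D, Nonempty (S ≃ₜ Circle))
    (hE : IsClosed (endPoints D))
    (f : D → D) (hf : Continuous f) (htrans : TopTransitive f) :
    IsTotallyDisconnected (omegaHyperspace f) := by
  have : LocallyPathConnectedSpace D := locallyPathConnectedSpace_of_locallyConnectedSpace
  have hpc : PathConnectedSpace D := PathConnectedSpace.of_locallyPathConnectedSpace
  refine isTotallyDisconnected_omegaHyperspace_of_frontier hf fun x B hB hx =>
    exists_isOpen_frontier_subset (T := {z | Dense (Set.range fun n : ℕ => f^[n] z)}) ?_ hB hx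
  intro x y hxy
  let γ : Path x y := (hpc.joined x y).somePath
  obtain ⟨α, hα, hαi, hα0, hα1, -⟩ := exists_arc_of_path (γ := γ.extend) γ.continuous_extend
    (by simpa using hxy)
  have hα0 : α 0 = x := by simpa using hα0
  have hα1 : α 1 = y := by simpa using hα1
  have hsep := isSeparatingArc_of_injOn hD hα hαi
  obtain ⟨O, hO, hOne, hOα⟩ := hsep.exists_isOpen_subset hE
  obtain ⟨p, hpO, hp⟩ := htrans.exists_denseRange_iterate hf hO hOne
  obtain ⟨t, ht, rfl⟩ := hOα hpO
  have htI : t ∈ Set.Icc (0 : ℝ) 1 := ⟨ht.1.le, ht.2.le⟩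
  refine ⟨α t, hp, fun h => ?_, fun h => ?_, ?_⟩
  · exact ht.1.ne' (hαi htI (by simp) (h.trans hα0.symm))
  · exact ht.2.ne (hαi htI (by simp) (h.trans hα1.symm))
  · rw [← hα0, ← hα1]
    exact hsep.separates t ht
end
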